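/- Let N ≥ 1, let a_1,…,a_k and b_1,…,b_{k'} be complex numbers, and let φ(e^{iθ}) = ∏_{i=1}^k (1 − a_i e^{iθ}) · ∏_{j=1}^{k'} (1 − b_j e^{−iθ}) with Fourier coefficients φ_n = (1/2π)∫_0^{2π} φ(e^{iθ}) e^{−inθ} dθ. Then ∫_{U(N)} ∏_{i=1}^k det(I − a_i U) · ∏_{j=1}^{k'} det(I − b_j U*) dU = det[(φ_{j−k})_{0≤j,k≤N−1}]. -/

import Mathlib

open MeasureTheory Matrix

instance matrixMS {m n α : Type*} [MeasurableSpace α] : MeasurableSpace (Matrix m n α) :=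
  inferInstanceAs (MeasurableSpace (m → n → α))

/-- The symbol `φ(e^{iθ}) = ∏_i (1 - a_i e^{iθ}) ∏_j (1 - b_j e^{-iθ})`. -/
noncomputable def phiSymbol {k k' : ℕ} (a : Fin k → ℂ) (b : Fin k' → ℂ) (θ : ℝ) : ℂ :=
  (∏ i, (1 - a i * Complex.exp (Complex.I * θ))) *
    ∏ j, (1 - b j * Complex.exp (-Complex.I * θ))

/-- The `n`-th Fourier coefficient `φ_n = (1/2π) ∫_0^{2π} φ(e^{iθ}) e^{-inθ} dθ`. -/
noncomputable def fCoeff (f : ℝ → ℂ) (n : ℤ) : ℂ :=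
  ((2 * Real.pi : ℝ) : ℂ)⁻¹ *
    ∫ θ in (0 : ℝ)..(2 * Real.pi), f θ * Complex.exp (-(n : ℂ) * Complex.I * θ)

namespace HeineSzego

section Alternant

open Polynomial

variable {K : ℕ}

/-- A univariate polynomial evaluated at the `i`-th variable. -/
noncomputable def atVar (i : Fin K) : ℂ[X] →ₐ[ℂ] MvPolynomial (Fin K) ℂ :=
  Polynomial.aeval (MvPolynomial.X i)

/-- The Vandermonde determinant of the variables. -/
noncomputable def vdm (K : ℕ) : MvPolynomial (Fin K) ℂ :=
  (vandermonde (fun i : Fin K => (MvPolynomial.X i : MvPolynomial (Fin K) ℂ))).det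

/-- The coefficient of `x ^ m` in `det (x_i ^ j) * ∏ i, p i (x_i)`. -/
noncomputable def altCoeff (m : Fin K → ℕ) (p : Fin K → ℂ[X]) : ℂ :=
  (Matrix.of fun i j : Fin K => (X ^ (j : ℕ) * p i).coeff (m i)).det

/-- The Euler operator `x_i ∂/∂x_i`. -/
noncomputable def euler (i : Fin K) :
    Derivation ℂ (MvPolynomial (Fin K) ℂ) (MvPolynomial (Fin K) ℂ) :=
  (MvPolynomial.X i : MvPolynomial (Fin K) ℂ) • MvPolynomial.pderiv i

lemma coeff_euler (i : Fin K) (p : MvPolynomial (Fin K) ℂ) (m : Fin K →₀ ℕ) :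
    (euler i p).coeff m = (m i : ℂ) * p.coeff m := by
  classical
  induction p using MvPolynomial.induction_on' with
  | monomial u a =>
    rw [euler, Derivation.smul_apply, smul_eq_mul, MvPolynomial.X_mul_pderiv_monomial]
    rw [← Nat.cast_smul_eq_nsmul ℂ, MvPolynomial.coeff_smul, MvPolynomial.coeff_monomial]
    split_ifs with h
    · rw [h, smul_eq_mul]
    · simp
  | add p q hp hq => rw [map_add, MvPolynomial.coeff_add, hp, hq, MvPolynomial.coeff_add, mul_add]

lemma euler_atVar_self (i : Fin K) (p : ℂ[X]) :
    euler i (atVar i p) = atVar i (X * derivative p) := by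
  rw [atVar, Derivation.map_aeval, map_mul, Polynomial.aeval_X, euler, Derivation.smul_apply,
    MvPolynomial.pderiv_X_self, smul_eq_mul, smul_eq_mul]
  ring

lemma euler_atVar_of_ne {i j : Fin K} (h : j ≠ i) (p : ℂ[X]) : euler i (atVar j p) = 0 := by
  rw [atVar, Derivation.map_aeval, euler, Derivation.smul_apply,
    MvPolynomial.pderiv_X_of_ne h, smul_zero, smul_zero]

lemma eval_atVar (x : Fin K → ℂ) (i : Fin K) (p : ℂ[X]) :
    MvPolynomial.eval x (atVar i p) = p.eval (x i) := by
  rw [atVar, Polynomial.aeval_def, Polynomial.hom_eval₂]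
  simp only [MvPolynomial.eval_X, MvPolynomial.algebraMap_eq]
  have : (MvPolynomial.eval x).comp MvPolynomial.C = RingHom.id ℂ := by ext; simp
  rw [this, Polynomial.eval₂_id]

lemma coeff_prod_atVar (m : Fin K →₀ ℕ) (p : Fin K → ℂ[X]) :
    (∏ i, atVar i (p i)).coeff m = ∏ i, (p i).coeff (m i) := by
  classical
  have h : ∀ i, atVar i (p i) =
      ∑ n ∈ (p i).support, MvPolynomial.monomial (Finsupp.single i n) ((p i).coeff n) := by
    intro i
    rw [atVar, Polynomial.aeval_eq_sum_range' (Nat.lt_succ_self _),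
      ← Finset.sum_subset Polynomial.supp_subset_range_natDegree_succ]
    · refine Finset.sum_congr rfl fun n _ => ?_
      rw [MvPolynomial.X_pow_eq_monomial, MvPolynomial.smul_monomial, smul_eq_mul, mul_one]
    · intro n _ hn
      rw [Polynomial.notMem_support_iff.1 hn, zero_smul]
  simp_rw [h]
  rw [Finset.prod_univ_sum]
  have hmon : ∀ f : Fin K → ℕ, ∏ i, MvPolynomial.monomial (Finsupp.single i (f i))
      ((p i).coeff (f i)) = MvPolynomial.monomial (Finsupp.equivFunOnFinite.symm f)
        (∏ i, (p i).coeff (f i)) := by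
    intro f
    rw [Finsupp.equivFunOnFinite_symm_eq_sum, MvPolynomial.monomial_sum_prod]
  simp_rw [hmon]
  rw [MvPolynomial.coeff_sum]
  simp_rw [MvPolynomial.coeff_monomial]
  have hm : ∀ f : Fin K → ℕ, Finsupp.equivFunOnFinite.symm f = m ↔ (m : Fin K → ℕ) = f := by
    intro f
    rw [Equiv.symm_apply_eq]
    exact eq_comm
  simp_rw [hm]
  rw [Finset.sum_ite_eq]
  split_ifs with h'
  · rfl
  · rw [Fintype.mem_piFinset] at h'
    push Not at h'
    obtain ⟨i, hi⟩ := h'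
    exact (Finset.prod_eq_zero (Finset.mem_univ i) (Polynomial.notMem_support_iff.1 hi)).symm

lemma coeff_vdm_mul (m : Fin K →₀ ℕ) (p : Fin K → ℂ[X]) :
    (vdm K * ∏ i, atVar i (p i)).coeff m = altCoeff m p := by
  rw [vdm, ← det_transpose, det_apply, Finset.sum_mul, MvPolynomial.coeff_sum, altCoeff,
    ← det_transpose, det_apply]
  refine Finset.sum_congr rfl fun σ _ => ?_
  simp only [transpose_apply, vandermonde_apply, of_apply]
  rw [← coeff_prod_atVar m (fun i => X ^ ((σ i : Fin K) : ℕ) * p i), smul_mul_assoc,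
    ← Finset.prod_mul_distrib]
  simp only [Units.smul_def, ← Int.cast_smul_eq_zsmul ℂ, MvPolynomial.coeff_smul, map_mul, map_pow]
  simp [atVar]

lemma eval_vdm (x : Fin K → ℂ) : MvPolynomial.eval x (vdm K) = (vandermonde x).det := by
  rw [vdm, RingHom.map_det]
  congr 1
  ext i j
  simp [vandermonde_apply]

lemma vdm_ne_zero : vdm K ≠ 0 := by
  rw [vdm, Matrix.det_vandermonde_ne_zero_iff]
  exact MvPolynomial.X_injective

lemma sum_of_coeff_vdm_ne_zero {m : Fin K →₀ ℕ} (h : (vdm K).coeff m ≠ 0) (f : ℕ → ℂ) :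
    ∑ i, f (m i) = ∑ i : Fin K, f i := by
  have h1 := coeff_vdm_mul m 1
  simp only [Pi.one_apply, map_one, Finset.prod_const_one, mul_one] at h1
  rw [h1, altCoeff, ← det_transpose, det_apply] at h
  obtain ⟨σ, -, hσ⟩ := Finset.exists_ne_zero_of_sum_ne_zero h
  have h2 : ∀ i, m i = (σ i : ℕ) := by
    intro i
    by_contra hi
    apply hσ
    rw [Finset.prod_eq_zero (Finset.mem_univ i), smul_zero]
    simp [coeff_X_pow, hi]
  simp_rw [h2]
  exact Equiv.sum_comp σ (fun i : Fin K => f i)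

lemma sum_euler_vdm : ∑ i, euler i (vdm K) = MvPolynomial.C (∑ i : Fin K, (i : ℂ)) * vdm K := by
  ext m
  rw [MvPolynomial.coeff_sum, MvPolynomial.coeff_C_mul]
  simp_rw [coeff_euler]
  rw [← Finset.sum_mul]
  by_cases h : (vdm K).coeff m = 0
  · rw [h, mul_zero, mul_zero]
  · rw [sum_of_coeff_vdm_ne_zero h (fun n => (n : ℂ))]

lemma sum_euler_euler_vdm : ∑ i, euler i (euler i (vdm K)) =
    MvPolynomial.C (∑ i : Fin K, (i : ℂ) ^ 2) * vdm K := by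
  ext m
  rw [MvPolynomial.coeff_sum, MvPolynomial.coeff_C_mul]
  simp_rw [coeff_euler, ← mul_assoc, ← sq]
  rw [← Finset.sum_mul]
  by_cases h : (vdm K).coeff m = 0
  · rw [h, mul_zero, mul_zero]
  · rw [sum_of_coeff_vdm_ne_zero h (fun n => (n : ℂ) ^ 2)]

lemma eq_of_eval_eq_of_ne_zero {D p q : MvPolynomial (Fin K) ℂ} (hD : D ≠ 0)
    (h : ∀ x, MvPolynomial.eval x D ≠ 0 → MvPolynomial.eval x p = MvPolynomial.eval x q) :
    p = q := by
  have : D * p = D * q := MvPolynomial.funext fun x => by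
    rw [map_mul, map_mul]
    by_cases hx : MvPolynomial.eval x D = 0
    · rw [hx, zero_mul, zero_mul]
    · rw [h x hx]
  exact mul_left_cancel₀ hD this

lemma eval_derivation_prod {ι : Type*} (s : Finset ι) (f : ι → MvPolynomial (Fin K) ℂ)
    (x : Fin K → ℂ) (hf : ∀ a ∈ s, MvPolynomial.eval x (f a) ≠ 0)
    (D : Derivation ℂ (MvPolynomial (Fin K) ℂ) (MvPolynomial (Fin K) ℂ)) :
    MvPolynomial.eval x (D (∏ a ∈ s, f a)) = MvPolynomial.eval x (∏ a ∈ s, f a) *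
      ∑ a ∈ s, MvPolynomial.eval x (D (f a)) / MvPolynomial.eval x (f a) := by
  classical
  induction s using Finset.induction_on with
  | empty => simp
  | insert a s ha ih =>
    have h1 := hf a (Finset.mem_insert_self _ _)
    have h2 := ih fun b hb => hf b (Finset.mem_insert_of_mem hb)
    rw [Finset.prod_insert ha, Derivation.leibniz, Finset.sum_insert ha]
    simp only [smul_eq_mul, map_add, map_mul, h2]
    field_simp
    ring

lemma euler_X (i j : Fin K) : euler i (MvPolynomial.X j) =
    if j = i then (MvPolynomial.X i : MvPolynomial (Fin K) ℂ) else 0 := by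
  classical
  rw [euler, Derivation.smul_apply, MvPolynomial.pderiv_X, Pi.single_apply]
  split_ifs <;> simp_all

lemma eval_euler_vdm {x : Fin K → ℂ} (hx : Function.Injective x) (i : Fin K) :
    MvPolynomial.eval x (euler i (vdm K)) = MvPolynomial.eval x (vdm K) *
      ∑ j ∈ Finset.univ.erase i, x i / (x i - x j) := by
  have hne : ∀ p, ∀ q ∈ Finset.Ioi p, MvPolynomial.eval x
      (MvPolynomial.X q - MvPolynomial.X p : MvPolynomial (Fin K) ℂ) ≠ 0 := by
    intro p q hq
    simp only [map_sub, MvPolynomial.eval_X, sub_ne_zero]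
    exact fun h => (Finset.mem_Ioi.1 hq).ne' (hx h)
  rw [vdm, det_vandermonde, eval_derivation_prod]
  swap
  · intro p _
    rw [map_prod]
    exact Finset.prod_ne_zero_iff.2 (hne p)
  congr 1
  have h1 : ∀ p : Fin K, MvPolynomial.eval x (euler i (∏ q ∈ Finset.Ioi p,
        (MvPolynomial.X q - MvPolynomial.X p : MvPolynomial (Fin K) ℂ))) /
      MvPolynomial.eval x (∏ q ∈ Finset.Ioi p,
        (MvPolynomial.X q - MvPolynomial.X p : MvPolynomial (Fin K) ℂ)) =
      ∑ q ∈ Finset.Ioi p, ((if q = i then x i / (x i - x p) else 0) +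
        (if p = i then x i / (x i - x q) else 0)) := by
    intro p
    rw [eval_derivation_prod _ _ _ (hne p), mul_div_cancel_left₀]
    swap
    · rw [map_prod]
      exact Finset.prod_ne_zero_iff.2 (hne p)
    refine Finset.sum_congr rfl fun q hq => ?_
    have hpq : p ≠ q := (Finset.mem_Ioi.1 hq).ne
    rw [map_sub, euler_X, euler_X]
    by_cases h : q = i
    · subst h
      simp [hpq]
    · by_cases h' : p = i
      · subst h'
        simp [h]
        rw [← neg_sub (x p) (x q), neg_div_neg_eq]
      · simp [h, h']
  simp_rw [h1, Finset.sum_add_distrib]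
  have h2 : ∑ p : Fin K, ∑ q ∈ Finset.Ioi p, (if q = i then x i / (x i - x p) else 0) =
      ∑ p ∈ Finset.Iio i, x i / (x i - x p) := by
    simp_rw [Finset.sum_ite_eq', Finset.mem_Ioi]
    rw [← Finset.sum_filter]
    congr 1
    ext; simp
  have h3 : ∑ p : Fin K, ∑ q ∈ Finset.Ioi p, (if p = i then x i / (x i - x q) else 0) =
      ∑ q ∈ Finset.Ioi i, x i / (x i - x q) := by
    rw [Finset.sum_eq_single i]
    · simp
    · intro p _ hp
      simp [hp]
    · simp
  rw [h2, h3, ← Finset.sum_union]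
  · congr 1
    ext j
    simp only [Finset.mem_union, Finset.mem_Iio, Finset.mem_Ioi, Finset.mem_erase,
      Finset.mem_univ, and_true]
    exact lt_or_lt_iff_ne
  · rw [Finset.disjoint_left]
    intro j hj hj'
    exact lt_asymm (Finset.mem_Iio.1 hj) (Finset.mem_Ioi.1 hj')

end Alternant

section Casimir

open Polynomial

variable {K : ℕ}

lemma euler_prod_atVar_of_notMem {s : Finset (Fin K)} {i : Fin K} (hi : i ∉ s) (p : ℂ[X]) :
    euler i (∏ l ∈ s, atVar l p) = 0 := by
  classical
  induction s using Finset.induction_on with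
  | empty => simp
  | insert a s ha ih =>
    rw [Finset.mem_insert, not_or] at hi
    rw [Finset.prod_insert ha, Derivation.leibniz, ih hi.2, euler_atVar_of_ne (Ne.symm hi.1)]
    simp

lemma euler_sub_prod_atVar {s : Finset (Fin K)} {i : Fin K} (hi : i ∈ s) (p : ℂ[X]) (N : ℂ) :
    euler i (∏ l ∈ s, atVar l p) - MvPolynomial.C N * ∏ l ∈ s, atVar l p =
      atVar i (X * derivative p - C N * p) * ∏ l ∈ s.erase i, atVar l p := by
  rw [← Finset.mul_prod_erase s _ hi, Derivation.leibniz,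
    euler_prod_atVar_of_notMem (Finset.notMem_erase i s), euler_atVar_self, map_sub,
    map_mul _ (C N)]
  have : atVar i (C N) = MvPolynomial.C N := by simp [atVar, MvPolynomial.algebraMap_eq]
  rw [this]
  simp only [smul_eq_mul]
  ring

/-- First-order relation: the Euler operator on `vdm * ∏ χ(x_i)`. -/
lemma sum_coeff_vdm_mul_eta (N : ℂ) (χ : ℂ[X]) (m : Fin K →₀ ℕ) :
    ∑ i, (vdm K * (atVar i (X * derivative χ - C N * χ) *
      ∏ l ∈ Finset.univ.erase i, atVar l χ)).coeff m =
      (∑ i, ((m i : ℂ) - N) - ∑ i : Fin K, (i : ℂ)) *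
        (vdm K * ∏ l, atVar l χ).coeff m := by
  have h : ∀ i, vdm K * (atVar i (X * derivative χ - C N * χ) *
      ∏ l ∈ Finset.univ.erase i, atVar l χ) =
      euler i (vdm K * ∏ l, atVar l χ) - MvPolynomial.C N * (vdm K * ∏ l, atVar l χ)
        - (∏ l, atVar l χ) * euler i (vdm K) := by
    intro i
    rw [← euler_sub_prod_atVar (Finset.mem_univ i), Derivation.leibniz]
    simp only [smul_eq_mul]
    ring
  rw [← MvPolynomial.coeff_sum]
  simp_rw [h, Finset.sum_sub_distrib]
  rw [← Finset.mul_sum (f := fun i => euler i (vdm K)), sum_euler_vdm]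
  simp only [MvPolynomial.coeff_sub, MvPolynomial.coeff_sum, coeff_euler, MvPolynomial.coeff_C_mul]
  rw [← Finset.sum_mul, mul_left_comm, MvPolynomial.coeff_C_mul, mul_comm (∏ l, _) (vdm K)]
  simp only [Finset.sum_const, nsmul_eq_mul]
  ring

/-- Second-order relation: the quadratic Casimir acts diagonally on the monomials of
`vdm * ∏ χ(x_i)`. -/
lemma sum_coeff_vdm_mul_eta_eta (N : ℂ) (χ : ℂ[X]) (Q : Fin K → Fin K → MvPolynomial (Fin K) ℂ)
    (hQ : ∀ i j, i ≠ j → ∀ x : Fin K → ℂ,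
      (x i - x j) * MvPolynomial.eval x (Q i j) =
        (x i - x j) * ((X * derivative χ - C N * χ).eval (x i) *
            (X * derivative χ - C N * χ).eval (x j)) +
          (x j * χ.eval (x i) * (X * derivative χ - C N * χ).eval (x j) -
            x i * χ.eval (x j) * (X * derivative χ - C N * χ).eval (x i)))
    (m : Fin K →₀ ℕ) :
    ∑ i, ∑ j ∈ Finset.univ.erase i, (vdm K * (Q i j *
        ∏ l ∈ (Finset.univ.erase i).erase j, atVar l χ)).coeff m =
      ((∑ i, ((m i : ℂ) - N) - ∑ i : Fin K, (i : ℂ)) ^ 2 - ∑ i, ((m i : ℂ) - N) ^ 2 +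
        ∑ i : Fin K, (i : ℂ) ^ 2) * (vdm K * ∏ l, atVar l χ).coeff m := by
  set η := X * derivative χ - C N * χ with hη
  set F : MvPolynomial (Fin K) ℂ := ∏ l, atVar l χ with hF
  set T : Fin K → MvPolynomial (Fin K) ℂ → MvPolynomial (Fin K) ℂ :=
    fun i p => euler i p - MvPolynomial.C N * p with hT
  -- the product rule for the shifted Euler operators
  have hTT : ∀ i, ∀ j ∈ Finset.univ.erase i, T j (T i (vdm K * F)) =
      vdm K * (atVar i η * atVar j η * ∏ l ∈ (Finset.univ.erase i).erase j, atVar l χ) +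
      (atVar i η * ∏ l ∈ Finset.univ.erase i, atVar l χ) * euler j (vdm K) +
      (atVar j η * ∏ l ∈ Finset.univ.erase j, atVar l χ) * euler i (vdm K) +
      F * euler j (euler i (vdm K)) := by
    intro i j hj
    have h1 : ∀ i, euler i F = atVar i η * ∏ l ∈ Finset.univ.erase i, atVar l χ +
        MvPolynomial.C N * F := by
      intro i
      rw [hη, ← euler_sub_prod_atVar (Finset.mem_univ i)]
      ring
    have h2 : euler j (∏ l ∈ Finset.univ.erase i, atVar l χ) =
        atVar j η * ∏ l ∈ (Finset.univ.erase i).erase j, atVar l χ +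
          MvPolynomial.C N * ∏ l ∈ Finset.univ.erase i, atVar l χ := by
      rw [hη, ← euler_sub_prod_atVar hj]
      ring
    have h3 : euler j (atVar i η) = 0 := euler_atVar_of_ne (Finset.ne_of_mem_erase hj).symm η
    have h4 : ∀ i, euler i (MvPolynomial.C N : MvPolynomial (Fin K) ℂ) = 0 := fun i =>
      (euler i).map_algebraMap N
    simp only [hT, Derivation.leibniz, smul_eq_mul, h1, map_add, map_sub, h2, h3, h4]
    ring
  have hswap : ∀ f : Fin K → Fin K → MvPolynomial (Fin K) ℂ,
      ∑ i, ∑ j ∈ Finset.univ.erase i, f i j = ∑ i, ∑ j ∈ Finset.univ.erase i, f j i := by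
    intro f
    refine Finset.sum_comm' fun i j => ?_
    simp [ne_comm]
  -- the difference-quotient part
  have hdiff : ∑ i, ∑ j ∈ Finset.univ.erase i, vdm K * ((Q i j - atVar i η * atVar j η) *
        ∏ l ∈ (Finset.univ.erase i).erase j, atVar l χ) =
      ∑ i, (-2) * ((atVar i η * ∏ l ∈ Finset.univ.erase i, atVar l χ) * euler i (vdm K)) := by
    refine eq_of_eval_eq_of_ne_zero (vdm_ne_zero (K := K)) fun x hx => ?_
    have hinj : Function.Injective x := by
      rw [eval_vdm] at hx
      exact det_vandermonde_ne_zero_iff.1 hx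
    simp only [map_sum, map_mul, map_sub, map_prod, eval_atVar, eval_euler_vdm hinj, map_neg,
      map_ofNat]
    set v := MvPolynomial.eval x (vdm K)
    have hterm : ∀ i, ∀ j ∈ Finset.univ.erase i,
        v * ((MvPolynomial.eval x (Q i j) - eval (x i) η * eval (x j) η) *
          ∏ l ∈ (Finset.univ.erase i).erase j, eval (x l) χ) =
        -(v * (eval (x i) η * (∏ l ∈ Finset.univ.erase i, eval (x l) χ) * (x i / (x i - x j)))) +
        -(v * (eval (x j) η * (∏ l ∈ Finset.univ.erase j, eval (x l) χ) *
          (x j / (x j - x i)))) := by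
      intro i j hj
      have hij : i ≠ j := (Finset.ne_of_mem_erase hj).symm
      have hne : x i - x j ≠ 0 := sub_ne_zero.2 fun h => hij (hinj h)
      have hne' : x j - x i ≠ 0 := sub_ne_zero.2 fun h => hij (hinj h).symm
      have hi : i ∈ Finset.univ.erase j := Finset.mem_erase.2 ⟨hij, Finset.mem_univ _⟩
      rw [← Finset.mul_prod_erase _ _ hj, ← Finset.mul_prod_erase _ _ hi,
        Finset.erase_right_comm (a := j)]
      have h5 : MvPolynomial.eval x (Q i j) - eval (x i) η * eval (x j) η =
          (x j * χ.eval (x i) * η.eval (x j) - x i * χ.eval (x j) * η.eval (x i)) /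
            (x i - x j) := by
        rw [eq_div_iff hne]
        linear_combination hQ i j hij x
      rw [h5, ← neg_sub (x i) (x j)]
      field_simp
      ring
    rw [Finset.sum_congr rfl fun i _ => Finset.sum_congr rfl (hterm i)]
    simp_rw [Finset.sum_add_distrib]
    have hsw : ∑ i, ∑ j ∈ Finset.univ.erase i, -(v * (eval (x j) η *
        (∏ l ∈ Finset.univ.erase j, eval (x l) χ) * (x j / (x j - x i)))) =
        ∑ i, ∑ j ∈ Finset.univ.erase i, -(v * (eval (x i) η *
        (∏ l ∈ Finset.univ.erase i, eval (x l) χ) * (x i / (x i - x j)))) := by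
      refine Finset.sum_comm' fun i j => ?_
      simp [ne_comm]
    rw [hsw, ← Finset.sum_add_distrib]
    refine Finset.sum_congr rfl fun i _ => ?_
    simp_rw [Finset.mul_sum]
    rw [← Finset.sum_add_distrib]
    refine Finset.sum_congr rfl fun j _ => ?_
    ring
  set t : ℂ := ∑ i : Fin K, (i : ℂ)
  set q : ℂ := ∑ i : Fin K, (i : ℂ) ^ 2
  have herase : ∀ i, ∀ f : Fin K → MvPolynomial (Fin K) ℂ,
      ∑ j ∈ Finset.univ.erase i, f j = ∑ j, f j - f i := fun i f => by
    rw [← Finset.sum_erase_add _ _ (Finset.mem_univ i), add_sub_cancel_right]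
  have hsum : ∑ i, ∑ j ∈ Finset.univ.erase i, T j (T i (vdm K * F)) =
      ∑ i, ∑ j ∈ Finset.univ.erase i, vdm K * (Q i j *
        ∏ l ∈ (Finset.univ.erase i).erase j, atVar l χ) +
      MvPolynomial.C (2 * t) * (∑ i, vdm K * (atVar i η * ∏ l ∈ Finset.univ.erase i, atVar l χ)) +
      MvPolynomial.C (t ^ 2 - q) * (vdm K * F) := by
    have hvdm : ∀ i, ∑ j ∈ Finset.univ.erase i, euler j (vdm K) =
        MvPolynomial.C t * vdm K - euler i (vdm K) := fun i => by rw [herase, sum_euler_vdm]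
    have hA : ∑ i, ∑ j ∈ Finset.univ.erase i, vdm K * (atVar i η * atVar j η *
          ∏ l ∈ (Finset.univ.erase i).erase j, atVar l χ) =
        ∑ i, ∑ j ∈ Finset.univ.erase i, vdm K * (Q i j *
          ∏ l ∈ (Finset.univ.erase i).erase j, atVar l χ) +
        ∑ i, 2 * ((atVar i η * ∏ l ∈ Finset.univ.erase i, atVar l χ) * euler i (vdm K)) := by
      simp_rw [sub_mul, mul_sub, Finset.sum_sub_distrib, neg_mul, Finset.sum_neg_distrib] at hdiff
      linear_combination -hdiff
    have hB : ∑ i, ∑ j ∈ Finset.univ.erase i,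
        (atVar i η * ∏ l ∈ Finset.univ.erase i, atVar l χ) * euler j (vdm K) =
        ∑ i, (atVar i η * ∏ l ∈ Finset.univ.erase i, atVar l χ) *
          (MvPolynomial.C t * vdm K - euler i (vdm K)) := by
      simp_rw [← Finset.mul_sum, hvdm]
    have hC : ∑ i, ∑ j ∈ Finset.univ.erase i, F * euler j (euler i (vdm K)) =
        F * (MvPolynomial.C (t ^ 2 - q) * vdm K) := by
      rw [hswap]
      have hCt : ∀ i, euler i (MvPolynomial.C t * vdm K) = MvPolynomial.C t * euler i (vdm K) := by
        intro i
        rw [← MvPolynomial.smul_eq_C_mul, Derivation.map_smul, MvPolynomial.smul_eq_C_mul]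
      simp_rw [← Finset.mul_sum, ← map_sum, hvdm, map_sub, hCt]
      rw [Finset.sum_sub_distrib, ← Finset.mul_sum, sum_euler_vdm, sum_euler_euler_vdm, map_pow]
      ring
    rw [Finset.sum_congr rfl fun i _ => Finset.sum_congr rfl (hTT i)]
    simp_rw [Finset.sum_add_distrib]
    rw [← hswap fun i j => (atVar i η * ∏ l ∈ Finset.univ.erase i, atVar l χ) * euler j (vdm K),
      hA, hB, hC]
    have hE : ∑ i, 2 * ((atVar i η * ∏ l ∈ Finset.univ.erase i, atVar l χ) * euler i (vdm K)) +
        2 * ∑ i, (atVar i η * ∏ l ∈ Finset.univ.erase i, atVar l χ) *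
          (MvPolynomial.C t * vdm K - euler i (vdm K)) =
        MvPolynomial.C (2 * t) *
          ∑ i, vdm K * (atVar i η * ∏ l ∈ Finset.univ.erase i, atVar l χ) := by
      rw [Finset.mul_sum, Finset.mul_sum, ← Finset.sum_add_distrib]
      refine Finset.sum_congr rfl fun i _ => ?_
      rw [map_mul, map_ofNat]
      ring
    linear_combination hE
  have hfirst := sum_coeff_vdm_mul_eta N χ m
  have hcoeff : ∀ i p, (T i p).coeff m = ((m i : ℂ) - N) * p.coeff m := by
    intro i p
    rw [hT, MvPolynomial.coeff_sub, coeff_euler, MvPolynomial.coeff_C_mul, sub_mul]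
  have hmain := congrArg (MvPolynomial.coeff m) hsum
  simp only [MvPolynomial.coeff_sum, hcoeff, MvPolynomial.coeff_add,
    MvPolynomial.coeff_C_mul] at hmain
  rw [hfirst] at hmain
  have hu : ∑ i, ∑ j ∈ Finset.univ.erase i, ((m j : ℂ) - N) * (((m i : ℂ) - N) *
      (vdm K * F).coeff m) =
      ((∑ i, ((m i : ℂ) - N)) ^ 2 - ∑ i, ((m i : ℂ) - N) ^ 2) * (vdm K * F).coeff m := by
    have h6 : ∀ i, ∑ j ∈ Finset.univ.erase i, ((m j : ℂ) - N) * (((m i : ℂ) - N) *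
        (vdm K * F).coeff m) = (∑ j, ((m j : ℂ) - N)) * (((m i : ℂ) - N) *
        (vdm K * F).coeff m) - ((m i : ℂ) - N) ^ 2 * (vdm K * F).coeff m := by
      intro i
      rw [← Finset.sum_mul, ← Finset.sum_erase_add _ _ (Finset.mem_univ i)]
      ring
    simp_rw [h6]
    rw [Finset.sum_sub_distrib, ← Finset.mul_sum, ← Finset.sum_mul, ← Finset.sum_mul]
    ring
  rw [hu] at hmain
  linear_combination -hmain

end Casimir

section Resolvent

open Polynomial

variable {N : ℕ}

/-- The polynomial matrix `U * adj (X - U)`. -/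
noncomputable def resMat (U : Matrix (Fin N) (Fin N) ℂ) : Matrix (Fin N) (Fin N) ℂ[X] :=
  U.map C * (charmatrix U).adjugate

/-- The quadratic form `v* A v`. -/
def quadForm (v : Fin N → ℂ) (A : Matrix (Fin N) (Fin N) ℂ) : ℂ :=
  ∑ a, ∑ b, star (v a) * v b * A a b

/-- The polynomial `v* U adj (X - U) v`. -/
noncomputable def resForm (U : Matrix (Fin N) (Fin N) ℂ) (v : Fin N → ℂ) : ℂ[X] :=
  ∑ a, ∑ b, C (star (v a) * v b) * resMat U a b

lemma eval_resMat (U : Matrix (Fin N) (Fin N) ℂ) (x : ℂ) :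
    (resMat U).map (eval x) = U * (scalar (Fin N) x - U).adjugate := by
  have h1 : (charmatrix U).map (evalRingHom x) = scalar (Fin N) x - U := by
    ext i j
    by_cases h : i = j
    · subst h; simp
    · simp [h]
  have h2 := RingHom.map_adjugate (evalRingHom x) (charmatrix U)
  rw [RingHom.mapMatrix_apply, RingHom.mapMatrix_apply, h1] at h2
  rw [← h2, resMat, ← coe_evalRingHom, Matrix.map_mul]
  congr 1
  ext i j
  simp

lemma eval_resForm (U : Matrix (Fin N) (Fin N) ℂ) (v : Fin N → ℂ) (x : ℂ) :
    (resForm U v).eval x = quadForm v (U * (scalar (Fin N) x - U).adjugate) := by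
  rw [← eval_resMat, resForm, quadForm]
  simp [eval_finsetSum]

lemma polynomial_eq_of_eval_eq {D p q : ℂ[X]} (hD : D ≠ 0)
    (h : ∀ x, D.eval x ≠ 0 → p.eval x = q.eval x) : p = q := by
  have : D * p = D * q := Polynomial.funext fun x => by
    rw [eval_mul, eval_mul]
    by_cases hx : D.eval x = 0
    · rw [hx, zero_mul, zero_mul]
    · rw [h x hx]
  exact mul_left_cancel₀ hD this

lemma adjugate_eq_det_smul_inv {A : Matrix (Fin N) (Fin N) ℂ} (h : A.det ≠ 0) :
    A.adjugate = A.det • A⁻¹ := by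
  rw [Matrix.inv_def, smul_smul, Ring.inverse_eq_inv', mul_inv_cancel₀ h, one_smul]

lemma quadForm_eq_dotProduct (v : Fin N → ℂ) (A : Matrix (Fin N) (Fin N) ℂ) :
    quadForm v A = star v ⬝ᵥ (A *ᵥ v) := by
  simp only [quadForm, dotProduct, mulVec, Pi.star_apply, Finset.mul_sum]
  refine Finset.sum_congr rfl fun a _ => Finset.sum_congr rfl fun b _ => ?_
  ring

/-- The characteristic polynomial under a rank-one left multiplication. -/
lemma charpoly_rank_one_mul (U : Matrix (Fin N) (Fin N) ℂ) (v : Fin N → ℂ) (s : ℂ) :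
    ((1 + s • vecMulVec v (star v)) * U).charpoly = U.charpoly - C s * resForm U v := by
  refine polynomial_eq_of_eval_eq U.charpoly_monic.ne_zero fun x hx => ?_
  rw [eval_sub, eval_mul, eval_C, eval_resForm, eval_charpoly, eval_charpoly]
  rw [eval_charpoly] at hx
  set M := scalar (Fin N) x - U with hM
  have h1 : scalar (Fin N) x - (1 + s • vecMulVec v (star v)) * U =
      M + replicateCol Unit (-(s • v)) * replicateRow Unit (star v ᵥ* U) := by
    rw [← vecMulVec_eq, add_mul, one_mul, smul_mul_assoc, hM, neg_vecMulVec, smul_vecMulVec,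
      vecMulVec_mul]
    abel
  rw [h1, det_add_replicateCol_mul_replicateRow (isUnit_iff_ne_zero.2 hx), det_unique (n := Unit),
    adjugate_eq_det_smul_inv hx, quadForm_eq_dotProduct, Matrix.mul_assoc, ← replicateCol_mulVec,
    Matrix.add_apply, Matrix.one_apply_eq, replicateRow_mul_replicateCol_apply, mulVec_neg,
    mulVec_smul, dotProduct_neg, dotProduct_smul, ← dotProduct_mulVec, mulVec_mulVec,
    mul_smul_comm, smul_mulVec, dotProduct_smul, smul_eq_mul, smul_eq_mul]
  ring

lemma mul_adjugate_scalar_sub (U : Matrix (Fin N) (Fin N) ℂ) (z : ℂ) :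
    U * (scalar (Fin N) z - U).adjugate = z • (scalar (Fin N) z - U).adjugate -
      (U.charpoly.eval z) • (1 : Matrix (Fin N) (Fin N) ℂ) := by
  rw [eval_charpoly, ← mul_adjugate, sub_mul, scalar_apply, ← smul_eq_diagonal_mul]
  abel

lemma trace_resMat (U : Matrix (Fin N) (Fin N) ℂ) :
    (resMat U).trace = X * derivative U.charpoly - C (N : ℂ) * U.charpoly := by
  refine polynomial_eq_of_eval_eq U.charpoly_monic.ne_zero fun x hx => ?_
  have htr : (resMat U).trace.eval x = (U * (scalar (Fin N) x - U).adjugate).trace := by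
    rw [← eval_resMat]
    simp [Matrix.trace, eval_finsetSum]
  rw [htr, eval_sub, eval_mul, eval_X, eval_mul, eval_C]
  have hx' := hx
  rw [eval_charpoly] at hx'
  set M := scalar (Fin N) x - U with hM
  have hder : (derivative U.charpoly).eval x = M.adjugate.trace := by
    have h2 : U.charpoly.comp (X + C x) =
        C M.det * det (1 + (X : ℂ[X]) • (M⁻¹).map C) := by
      refine Polynomial.funext fun r => ?_
      have h4 : eval r (det (1 + (X : ℂ[X]) • (M⁻¹).map C)) = det (1 + r • M⁻¹) := by
        simp [eval_det, ← smul_eq_mul_diagonal]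
      rw [eval_comp, eval_add, eval_X, eval_C, eval_charpoly, eval_mul, eval_C, h4, ← det_mul,
        mul_add, mul_one, mul_smul_comm, mul_nonsing_inv _ (isUnit_iff_ne_zero.2 hx'), hM, map_add,
        scalar_apply, ← smul_one_eq_diagonal]
      congr 1
      abel
    have h3 := congrArg (fun p => (derivative p).eval 0) h2
    simp only [derivative_comp, derivative_C_mul, eval_mul, eval_C,
      derivative_det_one_add_X_smul] at h3
    rw [adjugate_eq_det_smul_inv hx', trace_smul, smul_eq_mul, ← h3]
    simp
  rw [hM, mul_adjugate_scalar_sub, trace_sub, trace_smul, trace_smul, trace_one, hder,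
    Fintype.card_fin, smul_eq_mul, smul_eq_mul, mul_comm (N : ℂ)]

lemma resolvent_identity (U : Matrix (Fin N) (Fin N) ℂ) (x y : ℂ) :
    (x - y) • ((U * (scalar (Fin N) x - U).adjugate) * (U * (scalar (Fin N) y - U).adjugate)) =
      (y * U.charpoly.eval x) • (U * (scalar (Fin N) y - U).adjugate) -
      (x * U.charpoly.eval y) • (U * (scalar (Fin N) x - U).adjugate) := by
  have hB : (x - y) • ((scalar (Fin N) x - U).adjugate * (scalar (Fin N) y - U).adjugate) =
      (U.charpoly.eval x) • (scalar (Fin N) y - U).adjugate -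
      (U.charpoly.eval y) • (scalar (Fin N) x - U).adjugate := by
    have h1 : (scalar (Fin N) x - U).adjugate * ((scalar (Fin N) x - U) - (scalar (Fin N) y - U)) *
        (scalar (Fin N) y - U).adjugate = (U.charpoly.eval x) • (scalar (Fin N) y - U).adjugate -
      (U.charpoly.eval y) • (scalar (Fin N) x - U).adjugate := by
      rw [mul_sub, sub_mul, adjugate_mul, mul_assoc _ _ (adjugate _), mul_adjugate, eval_charpoly,
        eval_charpoly, smul_mul_assoc, one_mul, mul_smul_comm, mul_one]
    rw [← h1, sub_sub_sub_cancel_right, ← map_sub, mul_assoc, scalar_apply (x - y),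
      ← smul_eq_diagonal_mul, mul_smul_comm]
  rw [mul_adjugate_scalar_sub, mul_adjugate_scalar_sub]
  simp only [sub_mul, mul_sub, smul_mul_assoc, mul_smul_comm, one_mul, mul_one, smul_sub, smul_smul]
  linear_combination (norm := module) (x * y) • hB

/-- The test vectors `e_a + I ^ r e_b`. -/
noncomputable def testVec (a b : Fin N) (r : Fin 4) : Fin N → ℂ :=
  Pi.single a 1 + Complex.I ^ (r : ℕ) • Pi.single b 1

lemma quadForm_single (a : Fin N) (A : Matrix (Fin N) (Fin N) ℂ) :
    quadForm (Pi.single a 1) A = A a a := by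
  simp [quadForm_eq_dotProduct, Pi.star_single]

lemma quadForm_testVec (a b : Fin N) (r : Fin 4) (A : Matrix (Fin N) (Fin N) ℂ) :
    quadForm (testVec a b r) A = A a a + A b b + Complex.I ^ (r : ℕ) * A a b +
      (-Complex.I) ^ (r : ℕ) * A b a := by
  have : (Complex.I * -Complex.I) ^ (r : ℕ) = 1 := by simp
  rw [mul_pow] at this
  simp only [quadForm_eq_dotProduct, testVec, star_add, Pi.star_single, star_one, star_smul,
    mulVec_add, mulVec_smul, dotProduct_add, add_dotProduct, smul_dotProduct, dotProduct_smul,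
    star_pow, Complex.star_def, Complex.conj_I]
  simp
  linear_combination A b b * this

/-- A finite design: the test vectors average the product of two quadratic forms. -/
lemma sum_quadForm_mul (A B : Matrix (Fin N) (Fin N) ℂ) :
    ∑ a, ∑ b, ∑ r, quadForm (testVec a b r) A * quadForm (testVec a b r) B -
      8 * N * ∑ a, quadForm (Pi.single a 1) A * quadForm (Pi.single a 1) B =
      8 * (A.trace * B.trace + (A * B).trace) := by
  have h1 : ∀ a b, ∑ r, quadForm (testVec a b r) A * quadForm (testVec a b r) B =
      4 * (A a a * B a a) + 4 * (B b b * A b b) + 4 * (A a a * B b b) + 4 * (B a a * A b b) +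
        4 * (A a b * B b a) + 4 * (B a b * A b a) := by
    intro a b
    simp only [quadForm_testVec, Fin.sum_univ_four]
    norm_num [Complex.I_sq, pow_succ]
    ring_nf
    simp only [Complex.I_sq]
    ring
  have h2 : ∀ A B : Matrix (Fin N) (Fin N) ℂ, ∑ a, ∑ b, A a b * B b a = (A * B).trace := by
    intro A B
    simp [Matrix.trace, Matrix.mul_apply]
  have h3 : ∀ A B : Matrix (Fin N) (Fin N) ℂ, ∑ a, ∑ b, A a a * B b b = A.trace * B.trace := by
    intro A B
    simp [Matrix.trace, Finset.sum_mul_sum]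
  have h4 : ∑ a, ∑ _b : Fin N, A a a * B a a = N * ∑ a, A a a * B a a := by
    simp [Finset.mul_sum]
  have h5 : ∑ _a : Fin N, ∑ b, B b b * A b b = N * ∑ a, A a a * B a a := by
    simp [Finset.mul_sum, mul_comm]
  have h6 : ∀ f : Fin N → Fin N → ℂ, ∑ a, ∑ b, 4 * f a b = 4 * ∑ a, ∑ b, f a b := by
    intro f
    simp [Finset.mul_sum]
  simp only [h1, Finset.sum_add_distrib, quadForm_single]
  rw [h6 fun a _ => A a a * B a a, h6 fun _ b => B b b * A b b, h6 fun a b => A a a * B b b,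
    h6 fun a b => B a a * A b b, h6 fun a b => A a b * B b a, h6 fun a b => B a b * A b a,
    h2, h2, h3, h3, h4, h5, trace_mul_comm B A]
  ring

end Resolvent

section Average

open Polynomial

variable {N : ℕ}

instance borelSpace_matrix : BorelSpace (Matrix (Fin N) (Fin N) ℂ) :=
  inferInstanceAs (BorelSpace (Fin N → Fin N → ℂ))

instance borelSpace_unitaryGroup : BorelSpace (unitaryGroup (Fin N) ℂ) :=
  inferInstanceAs (BorelSpace {U : Matrix (Fin N) (Fin N) ℂ // U ∈ unitaryGroup (Fin N) ℂ})

instance compactSpace_unitaryGroup : CompactSpace (unitaryGroup (Fin N) ℂ) := by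
  have hc : IsCompact {A : Matrix (Fin N) (Fin N) ℂ | ∀ i, A i ∈
      {r : Fin N → ℂ | ∀ j, r j ∈ Metric.closedBall (0 : ℂ) 1}} :=
    isCompact_pi_infinite fun _ => isCompact_pi_infinite fun _ => isCompact_closedBall _ _
  refine isCompact_iff_compactSpace.1 (hc.of_isClosed_subset ?_ ?_)
  · have : (unitaryGroup (Fin N) ℂ : Set (Matrix (Fin N) (Fin N) ℂ)) = {A | A * star A = 1} := by
      ext A
      exact mem_unitaryGroup_iff
    rw [this]
    exact isClosed_eq (by fun_prop) continuous_const
  · intro A hA i j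
    simpa using entry_norm_bound_of_unitary hA i j

instance isTopologicalGroup_unitaryGroup : IsTopologicalGroup (unitaryGroup (Fin N) ℂ) :=
  inferInstanceAs (IsTopologicalGroup (unitary (Matrix (Fin N) (Fin N) ℂ)))

/-- The Haar average of `F` against the conjugate `k'`-th power of the determinant. -/
noncomputable def avg (μ : Measure (unitaryGroup (Fin N) ℂ)) (k' : ℕ)
    (F : Matrix (Fin N) (Fin N) ℂ → ℂ) : ℂ :=
  ∫ U : unitaryGroup (Fin N) ℂ, star (U : Matrix (Fin N) (Fin N) ℂ).det ^ k' * F U ∂μ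

lemma avg_const_mul (μ : Measure (unitaryGroup (Fin N) ℂ)) (k' : ℕ) (c : ℂ)
    (F : Matrix (Fin N) (Fin N) ℂ → ℂ) :
    avg μ k' (fun U => c * F U) = c * avg μ k' F := by
  rw [avg, avg, ← integral_const_mul]
  refine integral_congr_ae (.of_forall fun U => ?_)
  simp only
  ring

lemma avg_mul_left (μ : Measure (unitaryGroup (Fin N) ℂ)) [μ.IsMulLeftInvariant] (k' : ℕ)
    {g : Matrix (Fin N) (Fin N) ℂ} (hg : g ∈ unitaryGroup (Fin N) ℂ)
    (F : Matrix (Fin N) (Fin N) ℂ → ℂ) :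
    avg μ k' (fun U => F (g * U)) = g.det ^ k' * avg μ k' F := by
  have h1 : g.det * star g.det = 1 := by
    have := congrArg det (mem_unitaryGroup_iff.1 hg)
    rwa [det_mul, star_eq_conjTranspose, det_conjTranspose, det_one] at this
  rw [avg, avg, ← integral_mul_left_eq_self (μ := μ)
    (fun U => star (U : Matrix (Fin N) (Fin N) ℂ).det ^ k' * F U)
    (⟨g, hg⟩ : unitaryGroup (Fin N) ℂ),
    ← integral_const_mul]
  refine integral_congr_ae (.of_forall fun U => ?_)
  simp only [UnitaryGroup.mul_val, det_mul, star_mul, mul_pow]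
  have h2 : g.det ^ k' * star g.det ^ k' = 1 := by rw [← mul_pow, h1, one_pow]
  linear_combination -(star (U : Matrix (Fin N) (Fin N) ℂ).det ^ k' * F (g * U)) * h2

variable (μ : Measure (unitaryGroup (Fin N) ℂ)) [IsProbabilityMeasure μ] (k' : ℕ)

lemma integrable_of_continuous {f : unitaryGroup (Fin N) ℂ → ℂ} (hf : Continuous f) :
    Integrable f μ :=
  hf.integrable_of_hasCompactSupport (HasCompactSupport.of_compactSpace f)

lemma integrable_avg {F : Matrix (Fin N) (Fin N) ℂ → ℂ} (hF : Continuous F) :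
    Integrable (fun U : unitaryGroup (Fin N) ℂ =>
      star (U : Matrix (Fin N) (Fin N) ℂ).det ^ k' * F U) μ := by
  refine integrable_of_continuous μ ?_
  have : Continuous fun U : unitaryGroup (Fin N) ℂ => (U : Matrix (Fin N) (Fin N) ℂ) :=
    continuous_subtype_val
  exact ((this.matrix_det.star).pow k').mul (hF.comp this)

lemma avg_sum {ι : Type*} (s : Finset ι) {F : ι → Matrix (Fin N) (Fin N) ℂ → ℂ}
    (hF : ∀ i ∈ s, Continuous (F i)) :
    avg μ k' (fun U => ∑ i ∈ s, F i U) = ∑ i ∈ s, avg μ k' (F i) := by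
  simp only [avg, Finset.mul_sum]
  exact integral_finsetSum s fun i hi => integrable_avg μ k' (hF i hi)

lemma continuous_coeff_charpoly (p : ℕ) :
    Continuous fun U : Matrix (Fin N) (Fin N) ℂ => U.charpoly.coeff p := by
  have h : ∀ U : Matrix (Fin N) (Fin N) ℂ, U.charpoly.coeff p =
      MvPolynomial.eval (fun x : Fin N × Fin N => U x.1 x.2)
        ((charpoly.univ ℂ (Fin N)).coeff p) := by
    intro U
    have := charpoly.univ_coeff_eval₂Hom (n := Fin N) (RingHom.id ℂ)
      (fun x : Fin N × Fin N => U x.1 x.2) p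
    exact this.symm
  simp_rw [h]
  refine (MvPolynomial.continuous_eval _).comp (continuous_pi fun x => ?_)
  exact continuous_id.matrix_elem x.1 x.2

lemma continuous_coeff_resForm (v : Fin N → ℂ) (p : ℕ) :
    Continuous fun U : Matrix (Fin N) (Fin N) ℂ => (resForm U v).coeff p := by
  have h : ∀ U : Matrix (Fin N) (Fin N) ℂ, (resForm U v).coeff p =
      U.charpoly.coeff p - ((1 + (1 : ℂ) • vecMulVec v (star v)) * U).charpoly.coeff p := by
    intro U
    rw [charpoly_rank_one_mul]
    simp
  simp_rw [h]
  exact (continuous_coeff_charpoly p).sub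
    ((continuous_coeff_charpoly p).comp (continuous_const.mul continuous_id))

lemma continuous_altCoeff {K : ℕ} {T : Type*} [TopologicalSpace T] {p : T → Fin K → ℂ[X]}
    (hp : ∀ i n, Continuous fun t => (p t i).coeff n) (m : Fin K → ℕ) :
    Continuous fun t => altCoeff m (p t) := by
  refine Continuous.matrix_det (continuous_matrix fun i j => ?_)
  simp only [of_apply, coeff_X_pow_mul']
  split_ifs
  · exact hp i _
  · exact continuous_const

end Average

section RankOne

open Polynomial

variable {N : ℕ}

lemma one_add_rank_one_mem {v : Fin N → ℂ} {s : ℂ}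
    (hs : s + star s + quadForm v 1 * (s * star s) = 0) :
    1 + s • vecMulVec v (star v) ∈ unitaryGroup (Fin N) ℂ := by
  rw [mem_unitaryGroup_iff]
  have h1 : star (vecMulVec v (star v)) = vecMulVec v (star v) := by
    rw [star_eq_conjTranspose, conjTranspose_vecMulVec, star_star]
  have h2 : vecMulVec v (star v) * vecMulVec v (star v) =
      quadForm v 1 • vecMulVec v (star v) := by
    rw [vecMulVec_mul_vecMulVec, quadForm_eq_dotProduct, one_mulVec]
    ext i j
    simp [vecMulVec_apply]
    ring
  rw [star_add, star_one, star_smul, h1, add_mul, one_mul, mul_add, mul_one, smul_mul_smul_comm,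
    h2, smul_smul]
  have h3 : (s + star s + quadForm v 1 * (s * star s)) • vecMulVec v (star v) = 0 := by
    rw [hs, zero_smul]
  linear_combination (norm := module) h3

lemma det_one_add_rank_one (v : Fin N → ℂ) (s : ℂ) :
    (1 + s • vecMulVec v (star v)).det = 1 + s * quadForm v 1 := by
  rw [← smul_vecMulVec, vecMulVec_eq Unit, det_one_add_replicateCol_mul_replicateRow,
    quadForm_eq_dotProduct, one_mulVec, dotProduct_smul, smul_eq_mul]

lemma star_quadForm_one (v : Fin N → ℂ) : star (quadForm v 1) = quadForm v 1 := by
  rw [quadForm_eq_dotProduct, one_mulVec]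
  exact (star_dotProduct v v).symm

lemma infinite_unitary_parameters {w : ℂ} (hw : star w = w) :
    {s : ℂ | s + star s + w * (s * star s) = 0}.Infinite := by
  obtain ⟨w, rfl⟩ : ∃ r : ℝ, w = r := ⟨w.re, (Complex.conj_eq_iff_re.1 hw).symm⟩
  have hne : ∀ t : ℝ, (1 - Complex.I * t * w : ℂ) ≠ 0 := by
    intro t h
    have := congrArg Complex.re h
    simp at this
  have hne' : ∀ t : ℝ, (1 + Complex.I * t * w : ℂ) ≠ 0 := by
    intro t h
    have := congrArg Complex.re h
    simp at this
  refine Set.infinite_of_injective_forall_mem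
    (f := fun t : ℝ => 2 * Complex.I * t / (1 - Complex.I * t * w)) ?_ ?_
  · intro t u h
    simp only at h
    rw [div_eq_div_iff (hne t) (hne u)] at h
    have h2 : 2 * Complex.I * ((t : ℂ) - u) = 0 := by linear_combination h
    simpa [sub_eq_zero] using h2
  · intro t
    have h1 := hne t
    have h2 := hne' t
    simp only [Set.mem_ofPred_eq, Complex.star_def, map_div₀, map_mul, map_sub, Complex.conj_I,
      Complex.conj_ofReal, map_one, map_ofNat, sub_neg_eq_add, neg_mul, mul_neg]
    field_simp
    ring_nf

variable {K : ℕ}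

/-- The alternating coefficient in which the factors in `S` are resolvent forms. -/
noncomputable def mixedCoeff (m : Fin K →₀ ℕ) (v : Fin N → ℂ) (S : Finset (Fin K))
    (U : Matrix (Fin N) (Fin N) ℂ) : ℂ :=
  (vdm K * ((∏ i ∈ S, atVar i (resForm U v)) *
    ∏ i ∈ Finset.univ \ S, atVar i U.charpoly)).coeff m

lemma continuous_mixedCoeff (m : Fin K →₀ ℕ) (v : Fin N → ℂ) (S : Finset (Fin K)) :
    Continuous (mixedCoeff m v S) := by
  have h : ∀ U : Matrix (Fin N) (Fin N) ℂ, mixedCoeff m v S U =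
      altCoeff m fun i => if i ∈ S then resForm U v else U.charpoly := by
    intro U
    rw [← coeff_vdm_mul, mixedCoeff, ← Finset.prod_sdiff (Finset.subset_univ S),
      mul_comm (∏ i ∈ S, _)]
    congr 2
    congr 1
    · refine Finset.prod_congr rfl fun i hi => ?_
      rw [if_neg (Finset.mem_sdiff.1 hi).2]
    · refine Finset.prod_congr rfl fun i hi => ?_
      rw [if_pos hi]
  simp_rw [funext h]
  refine continuous_altCoeff (fun i n => ?_) m
  split_ifs
  · exact continuous_coeff_resForm v n
  · exact continuous_coeff_charpoly n

variable (μ : Measure (unitaryGroup (Fin N) ℂ)) [IsProbabilityMeasure μ] (k' : ℕ)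

lemma altCoeff_charpoly_rank_one_mul (m : Fin K →₀ ℕ) (v : Fin N → ℂ) (s : ℂ)
    (U : Matrix (Fin N) (Fin N) ℂ) :
    altCoeff m (fun _ => ((1 + s • vecMulVec v (star v)) * U).charpoly) =
      ∑ S : Finset (Fin K), (-s) ^ S.card * mixedCoeff m v S U := by
  have h : ∀ i : Fin K, atVar i (U.charpoly - C s * resForm U v) =
      MvPolynomial.C (-s) * atVar i (resForm U v) + atVar i U.charpoly := by
    intro i
    rw [map_sub, map_mul, ← algebraMap_eq, AlgHom.commutes, MvPolynomial.algebraMap_eq,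
      MvPolynomial.C_neg]
    ring
  rw [← coeff_vdm_mul]
  simp only [charpoly_rank_one_mul, h, Finset.prod_add, Finset.mul_sum, MvPolynomial.coeff_sum,
    Finset.powerset_univ, Finset.prod_mul_distrib, Finset.prod_const]
  refine Finset.sum_congr rfl fun S _ => ?_
  rw [mixedCoeff, ← MvPolynomial.coeff_C_mul, MvPolynomial.C_pow]
  congr 1
  ring

/-- The Haar averages of the alternating coefficients of `∏ i, charpoly U (x_i)`. -/
noncomputable def avgCoeff (m : Fin K → ℕ) : ℂ :=
  avg μ k' fun U => altCoeff m fun _ => U.charpoly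

lemma sum_avg_mixedCoeff [μ.IsMulLeftInvariant] (m : Fin K →₀ ℕ) (v : Fin N → ℂ) (n : ℕ) :
    (-1) ^ n * ∑ S ∈ Finset.univ.powersetCard n, avg μ k' (mixedCoeff m v S) =
      k'.choose n * quadForm v 1 ^ n * avgCoeff μ k' m := by
  have hpoly : ∑ S : Finset (Fin K), C ((-1) ^ S.card * avg μ k' (mixedCoeff m v S)) * X ^ S.card =
      C (avgCoeff μ k' m) * ((1 + X) ^ k').comp (C (quadForm v 1) * X) := by
    refine eq_of_infinite_eval_eq _ _
      ((infinite_unitary_parameters (star_quadForm_one v)).mono fun s hs => ?_)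
    have h1 := avg_mul_left μ k' (one_add_rank_one_mem hs)
      (fun U => altCoeff m fun _ : Fin K => U.charpoly)
    simp only [altCoeff_charpoly_rank_one_mul] at h1
    rw [avg_sum μ k' _ (F := fun S U => (-s) ^ S.card * mixedCoeff m v S U)
      fun S _ => continuous_const.mul (continuous_mixedCoeff m v S), det_one_add_rank_one] at h1
    simp only [avg_const_mul] at h1
    simp only [Set.mem_ofPred_eq, eval_finsetSum, eval_mul, eval_C, eval_pow, eval_X, eval_comp,
      eval_add, eval_one]
    rw [avgCoeff, mul_comm (avg _ _ _), mul_comm (quadForm v 1), ← h1]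
    refine Finset.sum_congr rfl fun S _ => ?_
    rw [neg_pow]
    ring
  have h := congrArg (fun p => coeff p n) hpoly
  simp only [finsetSum_coeff, coeff_C_mul, comp_C_mul_X_coeff, coeff_one_add_X_pow, coeff_X_pow,
    mul_ite, mul_one, mul_zero] at h
  rw [← Finset.sum_filter] at h
  rw [mul_comm _ (avgCoeff μ k' m), ← h, Finset.mul_sum]
  refine Finset.sum_congr ?_ fun S hS => ?_
  · ext S
    simp [Finset.mem_powersetCard, eq_comm]
  · rw [(Finset.mem_filter.1 hS).2]

end RankOne

section Selection

open Polynomial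

variable {N K : ℕ}

lemma exists_quadratic_design (N : ℕ) : ∃ (ι : Type) (_ : Fintype ι) (c : ι → ℂ)
    (w : ι → Fin N → ℂ), ∀ A B : Matrix (Fin N) (Fin N) ℂ,
      ∑ i, c i * (quadForm (w i) A * quadForm (w i) B) = A.trace * B.trace + (A * B).trace := by
  refine ⟨(Fin N × Fin N × Fin 4) ⊕ Fin N, inferInstance, Sum.elim (fun _ => 1 / 8) fun _ => -N,
    Sum.elim (fun z => testVec z.1 z.2.1 z.2.2) fun a => Pi.single a 1, fun A B => ?_⟩
  simp only [Fintype.sum_sum_type, Sum.elim_inl, Sum.elim_inr, Fintype.sum_prod_type,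
    ← Finset.mul_sum]
  linear_combination (1 / 8) * sum_quadForm_mul A B

lemma sum_pairs_eq_two_mul {α : Type*} [Fintype α] [DecidableEq α] (f : Finset α → ℂ) :
    ∑ i, ∑ j ∈ Finset.univ.erase i, f {i, j} = 2 * ∑ S ∈ Finset.univ.powersetCard 2, f S := by
  have h1 : ∑ i, ∑ j ∈ Finset.univ.erase i, f {i, j} =
      ∑ z ∈ Finset.univ.filter fun z : α × α => z.1 ≠ z.2, f {z.1, z.2} := by
    rw [Finset.sum_filter, Fintype.sum_prod_type]
    refine Finset.sum_congr rfl fun i _ => ?_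
    rw [← Finset.sum_filter]
    refine Finset.sum_congr ?_ fun _ _ => rfl
    ext j
    simp [eq_comm]
  rw [h1, Finset.mul_sum, ← Finset.sum_fiberwise_of_maps_to (g := fun z : α × α => {z.1, z.2})
    (t := Finset.univ.powersetCard 2)]
  · refine Finset.sum_congr rfl fun S hS => ?_
    obtain ⟨a, b, hab, rfl⟩ := Finset.card_eq_two.1 (Finset.mem_powersetCard.1 hS).2
    have h2 : ((Finset.univ.filter fun z : α × α => z.1 ≠ z.2).filter
        fun z : α × α => ({z.1, z.2} : Finset α) = {a, b}) = {(a, b), (b, a)} := by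
      ext ⟨x, y⟩
      simp only [Finset.mem_filter, Finset.mem_univ, true_and, Finset.mem_insert,
        Finset.mem_singleton, Prod.mk.injEq]
      constructor
      · rintro ⟨hxy, h⟩
        have hx : x = a ∨ x = b := by
          have : x ∈ ({a, b} : Finset α) := h ▸ Finset.mem_insert_self x {y}
          simpa using this
        have hy : y = a ∨ y = b := by
          have : y ∈ ({a, b} : Finset α) := h ▸ by simp
          simpa using this
        grind
      · rintro (⟨rfl, rfl⟩ | ⟨rfl, rfl⟩)
        · exact ⟨hab, rfl⟩
        · exact ⟨hab.symm, Finset.pair_comm _ _⟩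
    rw [h2, Finset.sum_pair (by simp [hab]), Finset.pair_comm b a, two_mul]
  · rintro ⟨x, y⟩ h
    simp only [Finset.mem_filter, Finset.mem_univ, true_and] at h
    simp [Finset.mem_powersetCard, Finset.card_pair h]

lemma sum_mixedCoeff_one (m : Fin K →₀ ℕ) (U : Matrix (Fin N) (Fin N) ℂ) :
    ∑ a, ∑ S ∈ Finset.univ.powersetCard 1, mixedCoeff m (Pi.single a 1) S U =
      (∑ i, ((m i : ℂ) - N) - ∑ i : Fin K, (i : ℂ)) * altCoeff m fun _ => U.charpoly := by
  have h : X * derivative U.charpoly - C (N : ℂ) * U.charpoly =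
      ∑ a, resForm U (Pi.single a 1) := by
    rw [← trace_resMat, Matrix.trace]
    refine Finset.sum_congr rfl fun a _ => Polynomial.funext fun x => ?_
    rw [eval_resForm, quadForm_single, ← eval_resMat]
    rfl
  rw [← coeff_vdm_mul, ← sum_coeff_vdm_mul_eta, Finset.sum_comm, Finset.powersetCard_one,
    Finset.sum_map]
  refine Finset.sum_congr rfl fun i _ => ?_
  rw [h, map_sum, Finset.sum_mul, Finset.mul_sum, MvPolynomial.coeff_sum]
  refine Finset.sum_congr rfl fun a _ => ?_
  simp [mixedCoeff, Finset.sdiff_singleton_eq_erase]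

lemma sum_mixedCoeff_two {ι : Type*} [Fintype ι] {c : ι → ℂ} {w : ι → Fin N → ℂ}
    (hw : ∀ A B : Matrix (Fin N) (Fin N) ℂ,
      ∑ z, c z * (quadForm (w z) A * quadForm (w z) B) = A.trace * B.trace + (A * B).trace)
    (m : Fin K →₀ ℕ) (U : Matrix (Fin N) (Fin N) ℂ) :
    ∑ z, c z * (2 * ∑ S ∈ Finset.univ.powersetCard 2, mixedCoeff m (w z) S U) =
      ((∑ i, ((m i : ℂ) - N) - ∑ i : Fin K, (i : ℂ)) ^ 2 - ∑ i, ((m i : ℂ) - N) ^ 2 +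
        ∑ i : Fin K, (i : ℂ) ^ 2) * altCoeff m fun _ => U.charpoly := by
  rw [← coeff_vdm_mul, ← sum_coeff_vdm_mul_eta_eta (N : ℂ) U.charpoly
    (fun i j => ∑ z, MvPolynomial.C (c z) *
      (atVar i (resForm U (w z)) * atVar j (resForm U (w z))))]
  · have hpair : ∀ z, 2 * ∑ S ∈ Finset.univ.powersetCard 2, mixedCoeff m (w z) S U =
        ∑ i, ∑ j ∈ Finset.univ.erase i, mixedCoeff m (w z) {i, j} U := fun z =>
      (sum_pairs_eq_two_mul fun S => mixedCoeff m (w z) S U).symm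
    simp only [hpair]
    simp only [Finset.mul_sum]
    rw [Finset.sum_comm]
    refine Finset.sum_congr rfl fun i _ => ?_
    rw [Finset.sum_comm]
    refine Finset.sum_congr rfl fun j hj => ?_
    rw [Finset.sum_mul, Finset.mul_sum, MvPolynomial.coeff_sum]
    refine Finset.sum_congr rfl fun z _ => ?_
    have hij : i ≠ j := (Finset.ne_of_mem_erase hj).symm
    have hset : (Finset.univ.erase i).erase j = Finset.univ \ {i, j} := by
      ext l
      simp [not_or, and_comm]
    rw [mixedCoeff, ← MvPolynomial.coeff_C_mul, Finset.prod_pair hij, hset]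
    congr 1
    ring
  · intro i j hij x
    rw [← trace_resMat]
    have htr : ∀ y, (resMat U).trace.eval y = (U * (scalar (Fin N) y - U).adjugate).trace := by
      intro y
      rw [← eval_resMat, Matrix.trace, Matrix.trace, eval_finsetSum]
      rfl
    simp only [map_sum, map_mul, MvPolynomial.eval_C, eval_atVar, eval_resForm, htr, hw]
    have := congrArg Matrix.trace (resolvent_identity U (x i) (x j))
    rw [trace_smul, trace_sub, trace_smul, trace_smul] at this
    simp only [smul_eq_mul] at this
    linear_combination this

variable (μ : Measure (unitaryGroup (Fin N) ℂ)) [IsProbabilityMeasure μ] (k' : ℕ)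

lemma avgCoeff_first_moment [μ.IsMulLeftInvariant] {m : Fin K →₀ ℕ} (h : avgCoeff μ k' m ≠ 0) :
    ∑ i, ((m i : ℂ) - N) - ∑ i : Fin K, (i : ℂ) = -(N * k') := by
  refine mul_right_cancel₀ h ?_
  rw [avgCoeff, ← avg_const_mul]
  simp only [← sum_mixedCoeff_one]
  rw [avg_sum μ k' _ fun a _ => continuous_finsetSum _ fun S _ => continuous_mixedCoeff m _ S]
  have h1 : ∀ a : Fin N, avg μ k' (fun U => ∑ S ∈ Finset.univ.powersetCard 1,
      mixedCoeff m (Pi.single a 1) S U) = -k' * avgCoeff μ k' m := by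
    intro a
    rw [avg_sum μ k' _ fun S _ => continuous_mixedCoeff m _ S]
    have := sum_avg_mixedCoeff μ k' m (Pi.single a 1) 1
    rw [quadForm_single, one_apply_eq] at this
    simp only [Nat.choose_one_right] at this
    linear_combination -this
  rw [Finset.sum_congr rfl fun a _ => h1 a, avgCoeff]
  simp
  ring

lemma avgCoeff_second_moment [μ.IsMulLeftInvariant] {m : Fin K →₀ ℕ} (h : avgCoeff μ k' m ≠ 0) :
    (∑ i, ((m i : ℂ) - N) - ∑ i : Fin K, (i : ℂ)) ^ 2 - ∑ i, ((m i : ℂ) - N) ^ 2 +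
        ∑ i : Fin K, (i : ℂ) ^ 2 = k' * (k' - 1) * (N * (N + 1)) := by
  obtain ⟨ι, _, c, w, hw⟩ := exists_quadratic_design N
  refine mul_right_cancel₀ h ?_
  rw [avgCoeff, ← avg_const_mul]
  simp only [← sum_mixedCoeff_two hw]
  rw [avg_sum μ k' _ (F := fun z U => c z * (2 * ∑ S ∈ Finset.univ.powersetCard 2,
    mixedCoeff m (w z) S U)) fun z _ => continuous_const.mul (continuous_const.mul
    (continuous_finsetSum _ fun S _ => continuous_mixedCoeff m _ S))]
  have h1 : ∀ z, avg μ k' (fun U => c z * (2 * ∑ S ∈ Finset.univ.powersetCard 2,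
      mixedCoeff m (w z) S U)) =
      c z * (quadForm (w z) 1 * quadForm (w z) 1) * (k' * (k' - 1) * avgCoeff μ k' m) := by
    intro z
    rw [avg_const_mul, avg_const_mul, avg_sum μ k' _ fun S _ => continuous_mixedCoeff m _ S]
    have := sum_avg_mixedCoeff μ k' m (w z) 2
    rw [Nat.cast_choose_two] at this
    linear_combination 2 * c z * this
  rw [Finset.sum_congr rfl fun a _ => h1 a, ← Finset.sum_mul, hw, avgCoeff]
  simp
  ring

end Selection

section Expansion

variable {N k k' : ℕ}

open Polynomial

/-- The exponents outside the block `[k', k' + N)`. -/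
def outerExp (N k' k : ℕ) : Fin (k' + k) → ℕ :=
  Fin.append (fun i => (i : ℕ)) fun j => k' + N + j

lemma outerExp_lt (i : Fin (k' + k)) : outerExp N k' k i < N + (k' + k) := by
  refine Fin.addCases (fun i => ?_) (fun j => ?_) i
  · simp only [outerExp, Fin.append_left]
    omega
  · simp only [outerExp, Fin.append_right]
    omega

lemma outerExp_injective : Function.Injective (outerExp N k' k) := by
  intro i j
  refine Fin.addCases (fun i => ?_) (fun i => ?_) i <;>
  refine Fin.addCases (fun j => ?_) (fun j => ?_) j <;>
  · simp only [outerExp, Fin.append_left, Fin.append_right, Fin.ext_iff, Fin.val_castAdd,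
      Fin.val_natAdd]
    omega

lemma mem_range_outerExp {y : ℕ} (hy : y < N + (k' + k)) (h : y < k' ∨ k' + N ≤ y) :
    ∃ i, outerExp N k' k i = y := by
  rcases h with h | h
  · exact ⟨Fin.castAdd k ⟨y, h⟩, by simp only [outerExp, Fin.append_left]⟩
  · refine ⟨Fin.natAdd k' ⟨y - (k' + N), by omega⟩, ?_⟩
    simp only [outerExp, Fin.append_right]
    omega

lemma outerExp_first_moment :
    ∑ i, ((outerExp N k' k i : ℂ) - N) - ∑ i : Fin (k' + k), (i : ℂ) = -(N * k') := by
  simp only [Fin.sum_univ_add, outerExp, Fin.append_left, Fin.append_right, Fin.val_castAdd,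
    Fin.val_natAdd, Nat.cast_add, Finset.sum_sub_distrib, Finset.sum_add_distrib]
  simp
  ring

lemma outerExp_second_moment :
    (∑ i, ((outerExp N k' k i : ℂ) - N) - ∑ i : Fin (k' + k), (i : ℂ)) ^ 2 -
      ∑ i, ((outerExp N k' k i : ℂ) - N) ^ 2 + ∑ i : Fin (k' + k), (i : ℂ) ^ 2 =
        k' * (k' - 1) * (N * (N + 1)) := by
  rw [outerExp_first_moment]
  have hg : 2 * ∑ i : Fin k', (i : ℂ) = k' * (k' - 1) := by
    rw [Fin.sum_univ_eq_sum_range (fun i => (i : ℂ)) k']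
    induction k' with
    | zero => simp
    | succ n ih =>
      rw [Finset.sum_range_succ, mul_add, ih]
      push_cast
      ring
  have h1 : ∀ i : Fin k', ((i : ℂ) - N) ^ 2 = (i : ℂ) ^ 2 - (N * 2) * i + (N : ℂ) ^ 2 := by
    intro i
    ring
  have h2 : ∀ j : Fin k, ((k' : ℂ) + N + j - N) ^ 2 = ((k' : ℂ) + j) ^ 2 := by
    intro i
    ring
  simp only [Fin.sum_univ_add, outerExp, Fin.append_left, Fin.append_right, Fin.val_castAdd,
    Fin.val_natAdd, Nat.cast_add, h1, h2]
  simp only [Finset.sum_sub_distrib, Finset.sum_add_distrib, ← Finset.mul_sum, Finset.sum_const,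
    Finset.card_univ, Fintype.card_fin, nsmul_eq_mul]
  linear_combination (N : ℂ) * hg

/-- The first two moments determine the exponents up to order. -/
lemma exists_perm_of_moments (hN : 1 ≤ N) {m : Fin (k' + k) → ℕ} (hm : Function.Injective m)
    (hlt : ∀ i, m i < N + (k' + k))
    (h1 : ∑ i, ((m i : ℂ) - N) - ∑ i : Fin (k' + k), (i : ℂ) = -(N * k'))
    (h2 : (∑ i, ((m i : ℂ) - N) - ∑ i : Fin (k' + k), (i : ℂ)) ^ 2 - ∑ i, ((m i : ℂ) - N) ^ 2 +
      ∑ i : Fin (k' + k), (i : ℂ) ^ 2 = k' * (k' - 1) * (N * (N + 1))) :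
    ∃ σ : Equiv.Perm (Fin (k' + k)), m = outerExp N k' k ∘ σ := by
  have hsum : ∑ i, ((m i : ℤ) - k') * ((m i : ℤ) - (N + k' - 1)) =
      ∑ i, ((outerExp N k' k i : ℤ) - k') * ((outerExp N k' k i : ℤ) - (N + k' - 1)) := by
    have h3 : ∀ f : Fin (k' + k) → ℕ, ∑ i, ((f i : ℂ) - k') * ((f i : ℂ) - (N + k' - 1)) =
        ∑ i, ((f i : ℂ) - N) ^ 2 + (N - 2 * k' + 1) * ∑ i, ((f i : ℂ) - N) +
          (k' + k : ℕ) * ((N - k') * (1 - k')) := by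
      intro f
      rw [Finset.mul_sum, ← Finset.sum_add_distrib]
      have : ((k' + k : ℕ) : ℂ) * ((N - k') * (1 - k')) =
          ∑ i : Fin (k' + k), ((N : ℂ) - k') * (1 - k') := by simp
      rw [this, ← Finset.sum_add_distrib]
      refine Finset.sum_congr rfl fun i _ => ?_
      ring
    have h4 : ∑ i, ((m i : ℂ) - k') * ((m i : ℂ) - (N + k' - 1)) =
        ∑ i, ((outerExp N k' k i : ℂ) - k') * ((outerExp N k' k i : ℂ) - (N + k' - 1)) := by
      rw [h3, h3]
      have h5 := outerExp_first_moment (N := N) (k' := k') (k := k)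
      have h6 := outerExp_second_moment (N := N) (k' := k') (k := k)
      rw [h1] at h2
      rw [h5] at h6
      linear_combination (N - 2 * k' + 1 : ℂ) * (h1 - h5) - h2 + h6
    exact_mod_cast h4
  have hcard : (Finset.univ.image m).card = (Finset.univ.image (outerExp N k' k)).card := by
    rw [Finset.card_image_of_injective _ hm, Finset.card_image_of_injective _ outerExp_injective]
  rw [← Finset.sum_image (s := Finset.univ) (g := m)
      (f := fun y : ℕ => ((y : ℤ) - k') * ((y : ℤ) - (N + k' - 1))) hm.injOn,
    ← Finset.sum_image (s := Finset.univ) (g := outerExp N k' k)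
      (f := fun y : ℕ => ((y : ℤ) - k') * ((y : ℤ) - (N + k' - 1))) outerExp_injective.injOn,
    ← Finset.sum_sdiff_eq_sum_sdiff_iff] at hsum
  set S := Finset.univ.image m
  set S₀ := Finset.univ.image (outerExp N k' k)
  have hle : ∑ y ∈ S \ S₀, ((y : ℤ) - k') * ((y : ℤ) - (N + k' - 1)) ≤ 0 := by
    refine Finset.sum_nonpos fun y hy => ?_
    obtain ⟨hy1, hy2⟩ := Finset.mem_sdiff.1 hy
    obtain ⟨i, -, rfl⟩ := Finset.mem_image.1 hy1
    have hblock : ¬ (m i < k' ∨ k' + N ≤ m i) := fun h => hy2 <| by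
      obtain ⟨j, hj⟩ := mem_range_outerExp (hlt i) h
      exact Finset.mem_image.2 ⟨j, Finset.mem_univ _, hj⟩
    exact mul_nonpos_of_nonneg_of_nonpos (by omega) (by omega)
  have hsub : S₀ \ S = ∅ := by
    by_contra hne
    have hpos : 0 < ∑ y ∈ S₀ \ S, ((y : ℤ) - k') * ((y : ℤ) - (N + k' - 1)) := by
      refine Finset.sum_pos (fun y hy => ?_) (Finset.nonempty_iff_ne_empty.2 hne)
      obtain ⟨i, -, rfl⟩ := Finset.mem_image.1 (Finset.mem_sdiff.1 hy).1
      refine Fin.addCases (fun i => ?_) (fun j => ?_) i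
      · simp only [outerExp, Fin.append_left]
        exact mul_pos_of_neg_of_neg (by omega) (by omega)
      · simp only [outerExp, Fin.append_right]
        exact mul_pos (by omega) (by omega)
    linarith
  have hS : S₀ = S := Finset.eq_of_subset_of_card_le (Finset.sdiff_eq_empty_iff_subset.1 hsub)
    hcard.le
  have hex : ∀ i, ∃ j, outerExp N k' k j = m i := by
    intro i
    have : m i ∈ S₀ := hS ▸ Finset.mem_image_of_mem m (Finset.mem_univ i)
    obtain ⟨j, -, hj⟩ := Finset.mem_image.1 this
    exact ⟨j, hj⟩
  choose σ hσ using hex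
  have hσi : Function.Injective σ := fun i j hij => hm (by rw [← hσ, ← hσ, hij])
  exact ⟨Equiv.ofBijective σ (Finite.injective_iff_bijective.1 hσi), funext fun i => (hσ i).symm⟩

lemma vandermonde_mul_prod_charpoly {K : ℕ} (U : Matrix (Fin N) (Fin N) ℂ) (x : Fin K → ℂ) :
    (vandermonde x).det * ∏ i, U.charpoly.eval (x i) =
      ∑ m : Fin K → Fin (N + K), (∏ i, x i ^ (m i : ℕ)) *
        altCoeff (fun i => (m i : ℕ)) fun _ => U.charpoly := by
  have h1 : (vandermonde x).det * ∏ i, U.charpoly.eval (x i) =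
      (of fun i => ∑ p : Fin (N + K), fun j : Fin K =>
        x i ^ (p : ℕ) * (X ^ (j : ℕ) * U.charpoly).coeff p).det := by
    rw [mul_comm, ← det_mul_column]
    congr 1
    ext i j
    have hd : (X ^ (j : ℕ) * U.charpoly).natDegree < N + K := by
      refine natDegree_mul_le.trans_lt ?_
      rw [charpoly_natDegree_eq_dim, natDegree_X_pow, Fintype.card_fin]
      omega
    rw [of_apply, of_apply, Finset.sum_apply, vandermonde_apply, mul_comm]
    have h2 := eval_eq_sum_range' hd (x i)
    rw [eval_mul, eval_pow, eval_X] at h2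
    rw [h2, Finset.sum_range]
    exact Finset.sum_congr rfl fun p _ => mul_comm _ _
  rw [h1]
  have h3 := (detRowAlternating (n := Fin K) (R := ℂ)).toMultilinearMap.map_sum
    (fun i (p : Fin (N + K)) (j : Fin K) => x i ^ (p : ℕ) * (X ^ (j : ℕ) * U.charpoly).coeff p)
  refine h3.trans (Finset.sum_congr rfl fun m _ => ?_)
  rw [altCoeff, ← det_mul_column]
  rfl

lemma avgCoeff_eq_zero_of_not_injective (μ : Measure (unitaryGroup (Fin N) ℂ))
    {K : ℕ} {m : Fin K → ℕ}
    (hm : ¬ Function.Injective m) : avgCoeff μ k' m = 0 := by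
  obtain ⟨i, j, hij, hne⟩ : ∃ i j, m i = m j ∧ i ≠ j := by
    simpa [Function.Injective] using hm
  have h : ∀ U : Matrix (Fin N) (Fin N) ℂ, (altCoeff m fun _ => U.charpoly) = 0 := fun U =>
    det_zero_of_row_eq hne (funext fun l => by simp [hij])
  simp [avgCoeff, avg, h]

lemma avgCoeff_comp_perm (μ : Measure (unitaryGroup (Fin N) ℂ)) {K : ℕ}
    (m : Fin K → ℕ) (σ : Equiv.Perm (Fin K)) :
    avgCoeff μ k' (m ∘ σ) = Equiv.Perm.sign σ * avgCoeff μ k' m := by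
  rw [avgCoeff, avgCoeff, ← avg_const_mul]
  congr 1
  funext U
  exact det_permute σ (of fun i j : Fin K => (X ^ (j : ℕ) * U.charpoly).coeff (m i))

/-- The average of a product of characteristic polynomials is a single alternant. -/
lemma vandermonde_mul_avg (μ : Measure (unitaryGroup (Fin N) ℂ)) [IsProbabilityMeasure μ]
    [μ.IsMulLeftInvariant] (hN : 1 ≤ N) (x : Fin (k' + k) → ℂ) :
    (vandermonde x).det * avg μ k' (fun U => ∏ i, U.charpoly.eval (x i)) =
      avgCoeff μ k' (outerExp N k' k) * (of fun i j => x i ^ outerExp N k' k j).det := by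
  rw [← avg_const_mul]
  simp only [vandermonde_mul_prod_charpoly]
  rw [avg_sum μ k' _ (F := fun (m : Fin (k' + k) → Fin (N + (k' + k))) U =>
      (∏ i, x i ^ (m i : ℕ)) * altCoeff (fun i => (m i : ℕ)) fun _ => U.charpoly)
    fun m _ => continuous_const.mul
      (continuous_altCoeff (fun _ n => continuous_coeff_charpoly n) _)]
  simp only [avg_const_mul]
  rw [det_apply', Finset.mul_sum]
  symm
  refine Finset.sum_of_injOn
    (fun (σ : Equiv.Perm (Fin (k' + k))) i => ⟨outerExp N k' k (σ⁻¹ i), outerExp_lt _⟩)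
    ?_ ?_ ?_ ?_
  · intro σ _ τ _ h
    refine inv_injective (Equiv.ext fun i => ?_)
    have := congrFun h i
    simp only [Fin.mk.injEq] at this
    exact outerExp_injective this
  · intro σ _
    exact Finset.mem_coe.2 (Finset.mem_univ _)
  · intro m _ hm
    by_contra hne
    obtain ⟨f, hf⟩ : ∃ f : Fin (k' + k) →₀ ℕ, ⇑f = fun i => (m i : ℕ) :=
      ⟨Finsupp.equivFunOnFinite.symm fun i => (m i : ℕ), rfl⟩
    have hI : avgCoeff μ k' f ≠ 0 := by
      rw [hf]
      exact right_ne_zero_of_mul hne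
    have h1 := avgCoeff_first_moment μ k' hI
    have h2 := avgCoeff_second_moment μ k' hI
    rw [hf] at hI
    simp only [hf] at h1 h2
    have hinj : Function.Injective fun i => (m i : ℕ) := by
      by_contra h
      exact hI (avgCoeff_eq_zero_of_not_injective μ h)
    obtain ⟨σ, hσ⟩ := exists_perm_of_moments hN hinj (fun i => (m i).2) h1 h2
    refine hm ⟨σ⁻¹, Finset.mem_coe.2 (Finset.mem_univ _), ?_⟩
    funext i
    refine Fin.ext ?_
    change outerExp N k' k (σ⁻¹⁻¹ i) = (m i : ℕ)
    rw [_root_.inv_inv σ]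
    exact (congrFun hσ i).symm
  · intro σ _
    have h := avgCoeff_comp_perm (k' := k') μ (outerExp N k' k) σ⁻¹
    rw [Equiv.Perm.sign_inv] at h
    change _ = _ * avgCoeff μ k' (outerExp N k' k ∘ ⇑σ⁻¹)
    rw [h, ← Equiv.prod_comp σ fun i => x i ^ outerExp N k' k (σ⁻¹ i)]
    have h3 : ∀ i, σ⁻¹ (σ i) = i := σ.symm_apply_apply
    simp only [of_apply, h3]
    ring

end Expansion

section Toeplitz

variable {N k k' : ℕ}

open Polynomial

/-- The Toeplitz determinant of the coefficients of `p`, centred at `k'`. -/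
noncomputable def toep (N k' : ℕ) (p : ℂ[X]) : ℂ :=
  (of fun j l : Fin N => (X ^ (l : ℕ) * p).coeff (k' + j)).det

lemma toep_C_mul (c : ℂ) (p : ℂ[X]) : toep N k' (C c * p) = c ^ N * toep N k' p := by
  have h : (of fun j l : Fin N => (X ^ (l : ℕ) * (C c * p)).coeff (k' + j)) =
      c • of fun j l : Fin N => (X ^ (l : ℕ) * p).coeff (k' + j) := by
    ext j l
    simp [mul_left_comm _ (C c)]
  rw [toep, toep, h, det_smul, Fintype.card_fin]

/-- The exponents, with the block `[k', k' + N)` listed first. -/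
def blockExp (N k' k : ℕ) : Fin N ⊕ Fin (k' + k) → Fin (N + (k' + k)) :=
  Sum.elim (fun j => ⟨k' + j, by omega⟩) fun j => ⟨outerExp N k' k j, outerExp_lt j⟩

/-- The exponents, with the block of the top `N` exponents listed first. -/
def topExp (N K : ℕ) : Fin N ⊕ Fin K → Fin (N + K) :=
  Sum.elim (fun j => ⟨K + j, by omega⟩) fun j => ⟨j, by omega⟩

lemma blockExp_bijective : Function.Bijective (blockExp N k' k) := by
  rw [Fintype.bijective_iff_injective_and_card]
  refine ⟨?_, by simp⟩
  have hout : ∀ j, outerExp N k' k j < k' ∨ k' + N ≤ outerExp N k' k j := by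
    intro j
    refine Fin.addCases (fun i => ?_) (fun i => ?_) j
    · simp [outerExp]
    · simp [outerExp]
  rintro (i | i) (j | j) h <;> simp only [blockExp, Sum.elim_inl, Sum.elim_inr, Fin.mk.injEq] at h
  · rw [Fin.ext (by omega : (i : ℕ) = j)]
  · have := hout j
    omega
  · have := hout i
    omega
  · rw [outerExp_injective h]

lemma topExp_bijective {K : ℕ} : Function.Bijective (topExp N K) := by
  rw [Fintype.bijective_iff_injective_and_card]
  refine ⟨?_, by simp⟩
  rintro (i | i) (j | j) h <;> simp only [topExp, Sum.elim_inl, Sum.elim_inr, Fin.mk.injEq] at h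
  · rw [Fin.ext (by omega : (i : ℕ) = j)]
  · omega
  · omega
  · rw [Fin.ext h]

/-- An alternant with exponents outside a block is a Toeplitz determinant times the
Vandermonde determinant. -/
lemma exists_alternant_eq_toep (N k' k : ℕ) : ∃ c : ℂ, ∀ x : Fin (k' + k) → ℂ,
    (of fun i j => x i ^ outerExp N k' k j).det =
      c * (vandermonde x).det * toep N k' (∏ i, (X - C (x i))) := by
  set π : Equiv.Perm (Fin N ⊕ Fin (k' + k)) :=
    (Equiv.ofBijective _ blockExp_bijective).trans (Equiv.ofBijective _ topExp_bijective).symm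
  have hπ : ∀ e, topExp N (k' + k) (π e) = blockExp N k' k e := fun e =>
    (Equiv.ofBijective _ topExp_bijective).apply_symm_apply _
  refine ⟨Equiv.Perm.sign π, fun x => ?_⟩
  set q : ℂ[X] := ∏ i, (X - C (x i)) with hq
  have hqm : q.Monic := monic_prod_X_sub_C x Finset.univ
  have hqd : q.natDegree = k' + k := by
    rw [hq, natDegree_prod_of_monic _ _ fun i _ => monic_X_sub_C _]
    simp
  have hXd : ∀ l : Fin N, (X ^ (l : ℕ) * q).natDegree = k' + k + l := by
    intro l
    rw [(monic_X_pow _).natDegree_mul hqm, hqd, natDegree_X_pow, add_comm]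
  have hXm : ∀ l : Fin N, (X ^ (l : ℕ) * q).Monic := fun l => (monic_X_pow _).mul hqm
  have hsum : ∀ f : Fin (N + (k' + k)) → ℂ, ∑ e, f (blockExp N k' k e) = ∑ p, f p := fun f =>
    (Equiv.ofBijective _ blockExp_bijective).sum_comp f
  set M : Matrix (Fin N ⊕ Fin (k' + k)) (Fin N ⊕ Fin (k' + k)) ℂ :=
    of fun r e => Sum.elim (fun l : Fin N => (X ^ (l : ℕ) * q).coeff (blockExp N k' k e))
      (fun j => if e = Sum.inr j then 1 else 0) r with hM
  set Q : Matrix (Fin N ⊕ Fin (k' + k)) (Fin N ⊕ Fin (k' + k)) ℂ :=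
    of fun e r => Sum.elim
      (fun l : Fin N => if (topExp N (k' + k) e : ℕ) = k' + k + l then 1 else 0)
      (fun i => x i ^ (topExp N (k' + k) e : ℕ)) r with hQ
  have hMdet : M.det = toep N k' q := by
    have : M = fromBlocks (of fun j l : Fin N => (X ^ (l : ℕ) * q).coeff (k' + j))ᵀ
        (of fun (l : Fin N) j => (X ^ (l : ℕ) * q).coeff (outerExp N k' k j)) 0 1 := by
      ext (r | r) (e | e)
      · simp [hM, blockExp]
      · simp [hM, blockExp]
      · simp [hM]
      · simp [hM, one_apply, eq_comm]
    rw [this, det_fromBlocks_zero₂₁, det_one, mul_one, det_transpose, toep]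
  have hQdet : Q.det = (vandermonde x).det := by
    have : Q = fromBlocks 1 (of fun (l : Fin N) i => x i ^ (k' + k + l : ℕ)) 0
        (vandermonde x)ᵀ := by
      ext (r | r) (e | e)
      · simp [hQ, topExp, one_apply, Fin.ext_iff]
      · simp [hQ, topExp]
      · have : (r : ℕ) ≠ k' + k + e := by omega
        simp [hQ, topExp, this]
      · simp [hQ, topExp, vandermonde_apply]
    rw [this, det_fromBlocks_zero₂₁, det_one, one_mul, det_transpose]
  have hprod : M * Q.submatrix π id = fromBlocks
      (of fun l l' : Fin N => (X ^ (l : ℕ) * q).coeff (k' + k + l')) 0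
      (of fun j (l' : Fin N) => if outerExp N k' k j = k' + k + l' then 1 else 0)
      (of fun i j => x i ^ outerExp N k' k j)ᵀ := by
    ext (r | r) (e | e)
    · simp only [mul_apply, hM, hQ, of_apply, submatrix_apply, id, Sum.elim_inl, hπ,
        fromBlocks_apply₁₁]
      rw [hsum fun p : Fin (N + (k' + k)) => (X ^ (r : ℕ) * q : ℂ[X]).coeff p *
          if (p : ℕ) = k' + k + e then 1 else 0,
        Finset.sum_eq_single (⟨k' + k + e, by omega⟩ : Fin (N + (k' + k)))]
      · simp
      · intro p _ hp
        rw [if_neg fun h => hp (Fin.ext h), mul_zero]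
      · simp
    · simp only [mul_apply, hM, hQ, of_apply, submatrix_apply, id, Sum.elim_inl, Sum.elim_inr, hπ,
        fromBlocks_apply₁₂, Matrix.zero_apply]
      rw [hsum fun p : Fin (N + (k' + k)) => (X ^ (r : ℕ) * q : ℂ[X]).coeff p * x e ^ (p : ℕ)]
      have h1 := eval_eq_sum_range' (p := X ^ (r : ℕ) * q) (n := N + (k' + k))
        (by rw [hXd]; omega) (x e)
      rw [Finset.sum_range] at h1
      rw [← h1, eval_mul, hq, eval_prod, Finset.prod_eq_zero (Finset.mem_univ e) (by simp),
        mul_zero]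
    · simp only [mul_apply, hM, hQ, of_apply, submatrix_apply, id, Sum.elim_inl, Sum.elim_inr, hπ,
        fromBlocks_apply₂₁, ite_mul, one_mul, zero_mul, Finset.sum_ite_eq', Finset.mem_univ,
        if_true, blockExp]
      rfl
    · simp [mul_apply, hM, hQ, hπ, blockExp]
  have hdet := congrArg det hprod
  have htri : (of fun l l' : Fin N => (X ^ (l : ℕ) * q).coeff (k' + k + l')).det = 1 := by
    rw [det_of_isLowerTriangular]
    · refine Finset.prod_eq_one fun l _ => ?_
      rw [of_apply, ← hXd l]
      exact hXm l
    · intro l l' h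
      have hlt : (l : ℕ) < l' := h
      rw [of_apply]
      refine coeff_eq_zero_of_natDegree_lt ?_
      rw [hXd]
      omega
  rw [det_mul, det_permute, hMdet, hQdet, det_fromBlocks_zero₁₂, htri, one_mul,
    det_transpose] at hdet
  rw [← hdet]
  ring

end Toeplitz

section Fourier

variable {N k k' : ℕ}

open Polynomial

/-- The polynomial `z ^ k' φ(z)`. -/
noncomputable def symbolPoly (a : Fin k → ℂ) (b : Fin k' → ℂ) : ℂ[X] :=
  (∏ i, (1 - C (a i) * X)) * ∏ j, (X - C (b j))

lemma phiSymbol_eq (a : Fin k → ℂ) (b : Fin k' → ℂ) (θ : ℝ) :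
    phiSymbol a b θ = Complex.exp (-(k' : ℂ) * Complex.I * θ) *
      (symbolPoly a b).eval (Complex.exp (Complex.I * θ)) := by
  have h : ∀ j, (1 - b j * Complex.exp (-Complex.I * θ)) =
      Complex.exp (-Complex.I * θ) * (Complex.exp (Complex.I * θ) - b j) := by
    intro j
    have : Complex.exp (-Complex.I * θ) * Complex.exp (Complex.I * θ) = 1 := by
      rw [← Complex.exp_add]
      simp
    linear_combination -this
  have h2 : Complex.exp (-(k' : ℂ) * Complex.I * θ) = Complex.exp (-Complex.I * θ) ^ k' := by
    rw [← Complex.exp_nat_mul]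
    congr 1
    ring
  simp only [phiSymbol, h, symbolPoly, eval_mul, eval_prod, Finset.prod_mul_distrib, h2]
  simp
  ring

lemma integral_exp_int (n : ℤ) :
    ∫ θ in (0 : ℝ)..(2 * Real.pi), Complex.exp ((n : ℂ) * Complex.I * θ) =
      if n = 0 then ((2 * Real.pi : ℝ) : ℂ) else 0 := by
  split_ifs with h
  · simp [h]
  · have hc : (n : ℂ) * Complex.I ≠ 0 := by simp [h]
    rw [integral_exp_mul_complex hc]
    have h1 : Complex.exp ((n : ℂ) * Complex.I * ((2 * Real.pi : ℝ) : ℂ)) = 1 := by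
      rw [Complex.exp_eq_one_iff]
      exact ⟨n, by push_cast; ring⟩
    rw [h1]
    simp

lemma fCoeff_phiSymbol (a : Fin k → ℂ) (b : Fin k' → ℂ) (j l : ℕ) :
    fCoeff (phiSymbol a b) ((j : ℤ) - l) = (X ^ l * symbolPoly a b).coeff (k' + j) := by
  have h : ∀ θ : ℝ, phiSymbol a b θ * Complex.exp (-(((j : ℤ) - l : ℤ) : ℂ) * Complex.I * θ) =
      ∑ p ∈ (X ^ l * symbolPoly a b).support, (X ^ l * symbolPoly a b).coeff p *
        Complex.exp (((((p : ℕ) : ℤ) - (k' + j : ℕ) : ℤ) : ℂ) * Complex.I * θ) := by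
    intro θ
    have h1 : phiSymbol a b θ * Complex.exp (-(((j : ℤ) - l : ℤ) : ℂ) * Complex.I * θ) =
        Complex.exp (-((k' + j : ℕ) : ℂ) * Complex.I * θ) *
          (X ^ l * symbolPoly a b).eval (Complex.exp (Complex.I * θ)) := by
      rw [phiSymbol_eq, eval_mul, eval_pow, eval_X, ← Complex.exp_nat_mul, mul_right_comm,
        ← Complex.exp_add, ← mul_assoc, ← Complex.exp_add]
      congr 2
      push_cast
      ring
    rw [h1, eval_eq_sum, sum_def, Finset.mul_sum]
    refine Finset.sum_congr rfl fun p _ => ?_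
    rw [← Complex.exp_nat_mul, mul_left_comm, ← Complex.exp_add]
    congr 2
    push_cast
    ring
  rw [fCoeff, intervalIntegral.integral_congr fun θ _ => h θ,
    intervalIntegral.integral_finsetSum fun p _ =>
      Continuous.intervalIntegrable (by fun_prop) _ _]
  simp only [intervalIntegral.integral_const_mul, integral_exp_int]
  have hpi : ((2 * Real.pi : ℝ) : ℂ) ≠ 0 := by
    exact_mod_cast Real.two_pi_pos.ne'
  have h2 : ∀ p : ℕ, ((p : ℤ) - (k' + j : ℕ) = 0) ↔ p = k' + j := by
    intro p
    omega
  simp only [h2, mul_ite, mul_zero, Finset.sum_ite_eq']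
  split_ifs with h3
  · field_simp
  · exact (notMem_support_iff.1 h3).symm

lemma det_fCoeff_eq_toep (a : Fin k → ℂ) (b : Fin k' → ℂ) :
    (of fun j l : Fin N => fCoeff (phiSymbol a b) (((j : ℕ) : ℤ) - ((l : ℕ) : ℤ))).det =
      toep N k' (symbolPoly a b) := by
  simp only [fCoeff_phiSymbol, toep]

end Fourier

section Assembly

variable {N k k' : ℕ}

open Polynomial

/-- The average over the unitary group in the Heine–Szegő identity. -/
noncomputable def detAvg (μ : Measure (unitaryGroup (Fin N) ℂ)) (a : Fin k → ℂ)
    (b : Fin k' → ℂ) : ℂ :=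
  ∫ U : unitaryGroup (Fin N) ℂ,
    (∏ i : Fin k, ((1 : Matrix (Fin N) (Fin N) ℂ) - a i • (U : Matrix (Fin N) (Fin N) ℂ)).det) *
      (∏ j : Fin k',
        ((1 : Matrix (Fin N) (Fin N) ℂ) - b j • star (U : Matrix (Fin N) (Fin N) ℂ)).det) ∂μ

lemma det_one_sub_smul {a : ℂ} (ha : a ≠ 0) (U : Matrix (Fin N) (Fin N) ℂ) :
    (1 - a • U).det = a ^ N * U.charpoly.eval a⁻¹ := by
  have h : 1 - a • U = a • (scalar (Fin N) a⁻¹ - U) := by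
    rw [smul_sub, scalar_apply, ← smul_one_eq_diagonal, smul_smul, mul_inv_cancel₀ ha, one_smul]
  rw [h, det_smul, Fintype.card_fin, eval_charpoly]

lemma det_one_sub_smul_star (b : ℂ) {U : Matrix (Fin N) (Fin N) ℂ}
    (hU : U ∈ unitaryGroup (Fin N) ℂ) :
    (1 - b • star U).det = (-1) ^ N * (star U.det * U.charpoly.eval b) := by
  have h : 1 - b • star U = (-1 : ℂ) • ((scalar (Fin N) b - U) * star U) := by
    rw [sub_mul, mem_unitaryGroup_iff.1 hU, scalar_apply, ← smul_one_eq_diagonal, smul_mul_assoc,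
      one_mul, neg_one_smul, neg_sub]
  rw [h, det_smul, Fintype.card_fin, eval_charpoly, det_mul, star_eq_conjTranspose,
    det_conjTranspose, mul_comm (star _)]

lemma detAvg_eq_avg (μ : Measure (unitaryGroup (Fin N) ℂ)) {a : Fin k → ℂ} (ha : ∀ i, a i ≠ 0)
    (b : Fin k' → ℂ) :
    detAvg μ a b = (∏ i, a i) ^ N * ((-1) ^ N) ^ k' *
      avg μ k' fun U => ∏ i, U.charpoly.eval (Fin.append b (fun i => (a i)⁻¹) i) := by
  rw [avg, ← integral_const_mul, detAvg]
  refine integral_congr_ae (.of_forall fun U => ?_)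
  simp only [det_one_sub_smul (ha _), det_one_sub_smul_star _ U.2, Fin.prod_univ_add,
    Fin.append_left, Fin.append_right, Finset.prod_mul_distrib, Finset.prod_const,
    Finset.card_univ, Fintype.card_fin, Finset.prod_pow]
  ring

lemma symbolPoly_eq {a : Fin k → ℂ} (ha : ∀ i, a i ≠ 0) (b : Fin k' → ℂ) :
    symbolPoly a b = C ((-1) ^ k * ∏ i, a i) *
      ∏ i, (X - C (Fin.append b (fun i => (a i)⁻¹) i)) := by
  have h : ∀ i, (1 - C (a i) * X : ℂ[X]) = C (-1) * (C (a i) * (X - C (a i)⁻¹)) := by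
    intro i
    rw [mul_sub, ← C_mul, mul_inv_cancel₀ (ha i)]
    simp
  simp only [symbolPoly, h, Fin.prod_univ_add, Fin.append_left, Fin.append_right,
    Finset.prod_mul_distrib, Finset.prod_const, Finset.card_univ, Fintype.card_fin, C_mul,
    C_pow, map_prod]
  ring

/-- The identity up to a constant, at generic parameters. -/
lemma exists_detAvg_eq_const_mul_toep (hN : 1 ≤ N) (k k' : ℕ)
    (μ : Measure (unitaryGroup (Fin N) ℂ)) [IsProbabilityMeasure μ] [μ.IsMulLeftInvariant] :
    ∃ c : ℂ, ∀ (a : Fin k → ℂ) (b : Fin k' → ℂ), (∀ i, a i ≠ 0) → Function.Injective a →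
      Function.Injective b → (∀ i j, a i * b j ≠ 1) →
        detAvg μ a b = c * toep N k' (symbolPoly a b) := by
  obtain ⟨c, hc⟩ := exists_alternant_eq_toep N k' k
  refine ⟨((-1) ^ N) ^ k' * ((-1) ^ k) ^ N * avgCoeff μ k' (outerExp N k' k) * c,
    fun a b ha hai hbi hab => ?_⟩
  have hinj : Function.Injective (Fin.append b fun i => (a i)⁻¹) := by
    rw [Fin.append_injective_iff]
    refine ⟨hbi, fun i j h => hai (inv_injective h), fun i j h => hab j i ?_⟩
    rw [h, mul_inv_cancel₀ (ha j)]
  have h1 := vandermonde_mul_avg (k := k) (k' := k') μ hN (Fin.append b fun i => (a i)⁻¹)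
  rw [hc] at h1
  have h2 := mul_left_cancel₀ (det_vandermonde_ne_zero_iff.2 hinj)
    (h1.trans (by ring : _ = (vandermonde (Fin.append b fun i => (a i)⁻¹)).det *
      (avgCoeff μ k' (outerExp N k' k) * c *
        toep N k' (∏ i, (X - C (Fin.append b (fun i => (a i)⁻¹) i))))))
  rw [detAvg_eq_avg μ ha, h2, symbolPoly_eq ha, toep_C_mul]
  have h3 : (((-1 : ℂ) ^ k) ^ N) * (((-1 : ℂ) ^ k) ^ N) = 1 := by
    rw [← mul_pow, ← mul_pow]
    simp
  rw [mul_pow]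
  linear_combination -((∏ i, a i) ^ N * ((-1) ^ N) ^ k' * (avgCoeff μ k' (outerExp N k' k) * c *
        toep N k' (∏ i, (X - C (Fin.append b (fun i => (a i)⁻¹) i))))) * h3

lemma continuous_coeff_mul {T : Type*} [TopologicalSpace T] {p q : T → ℂ[X]}
    (hp : ∀ n, Continuous fun t => (p t).coeff n) (hq : ∀ n, Continuous fun t => (q t).coeff n)
    (n : ℕ) : Continuous fun t => (p t * q t).coeff n := by
  simp only [coeff_mul]
  exact continuous_finsetSum _ fun z _ => (hp _).mul (hq _)

lemma continuous_coeff_prod {T ι : Type*} [TopologicalSpace T] (s : Finset ι) {p : ι → T → ℂ[X]}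
    (hp : ∀ i n, Continuous fun t => (p i t).coeff n) (n : ℕ) :
    Continuous fun t => (∏ i ∈ s, p i t).coeff n := by
  classical
  induction s using Finset.induction_on generalizing n with
  | empty => simpa using continuous_const
  | insert i s hi ih =>
    simp only [Finset.prod_insert hi]
    exact continuous_coeff_mul (hp i) ih n

lemma continuous_toep_symbolPoly {T : Type*} [TopologicalSpace T] {a : T → Fin k → ℂ}
    {b : T → Fin k' → ℂ} (ha : Continuous a) (hb : Continuous b) :
    Continuous fun t => toep N k' (symbolPoly (a t) (b t)) := by
  refine Continuous.matrix_det (continuous_matrix fun j l => ?_)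
  simp only [of_apply]
  refine continuous_coeff_mul (fun _ => continuous_const) (fun n => ?_) _
  refine continuous_coeff_mul (fun n => ?_) (fun n => ?_) n
  · refine continuous_coeff_prod _ (fun i n => ?_) n
    simp only [coeff_sub, coeff_C_mul]
    fun_prop
  · refine continuous_coeff_prod _ (fun i n => ?_) n
    simp only [coeff_sub, coeff_C]
    split_ifs <;> fun_prop

lemma continuous_detAvg (μ : Measure (unitaryGroup (Fin N) ℂ)) [IsProbabilityMeasure μ]
    {a : ℂ → Fin k → ℂ} {b : ℂ → Fin k' → ℂ} (ha : Continuous a) (hb : Continuous b) :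
    Continuous fun t => detAvg μ (a t) (b t) := by
  simp only [detAvg]
  have h := continuous_parametric_integral_of_continuous (μ := μ)
    (f := fun (t : ℂ) (U : unitaryGroup (Fin N) ℂ) =>
    (∏ i : Fin k, ((1 : Matrix (Fin N) (Fin N) ℂ) - a t i • (U : Matrix (Fin N) (Fin N) ℂ)).det) *
      (∏ j : Fin k',
        ((1 : Matrix (Fin N) (Fin N) ℂ) - b t j • star (U : Matrix (Fin N) (Fin N) ℂ)).det))
    ?_ (isCompact_univ)
  · simpa only [setIntegral_univ] using h
  · have hU : Continuous fun z : ℂ × unitaryGroup (Fin N) ℂ =>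
      (z.2 : Matrix (Fin N) (Fin N) ℂ) := continuous_subtype_val.comp continuous_snd
    refine Continuous.mul ?_ ?_
    · refine continuous_finsetProd _ fun i _ => Continuous.matrix_det ?_
      have : Continuous fun z : ℂ × unitaryGroup (Fin N) ℂ => a z.1 i := by fun_prop
      exact continuous_const.sub (this.smul hU)
    · refine continuous_finsetProd _ fun i _ => Continuous.matrix_det ?_
      have : Continuous fun z : ℂ × unitaryGroup (Fin N) ℂ => b z.1 i := by fun_prop
      exact continuous_const.sub (this.smul hU.star)

open Filter Topology in
lemma eventually_eval_ne_zero {p : ℂ[X]} (hp : p ≠ 0) : ∀ᶠ t in 𝓝[≠] (0 : ℂ), p.eval t ≠ 0 := by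
  have hfin : ({t | p.eval t = 0} \ {0}).Finite :=
    (p.roots.toFinset.finite_toSet.subset fun t ht => by simpa [hp] using ht).sdiff
  have h0 : ∀ᶠ t in 𝓝 (0 : ℂ), t ∉ {t | p.eval t = 0} \ {0} :=
    hfin.isClosed.isOpen_compl.mem_nhds (by simp)
  filter_upwards [nhdsWithin_le_nhds h0, self_mem_nhdsWithin] with t ht ht0 h
  exact ht ⟨h, ht0⟩

open Filter Topology in
lemma detAvg_eq_const_mul_toep (hN : 1 ≤ N) (k k' : ℕ) (μ : Measure (unitaryGroup (Fin N) ℂ))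
    [IsProbabilityMeasure μ] [μ.IsMulLeftInvariant] :
    ∃ c : ℂ, ∀ (a : Fin k → ℂ) (b : Fin k' → ℂ),
      detAvg μ a b = c * toep N k' (symbolPoly a b) := by
  obtain ⟨c, hc⟩ := exists_detAvg_eq_const_mul_toep hN k k' μ
  refine ⟨c, fun a b => ?_⟩
  have hlin : ∀ x y : ℂ, y ≠ 0 → ∀ᶠ t in 𝓝[≠] (0 : ℂ), x + t * y ≠ 0 := by
    intro x y hy
    have hp : (C x + X * C y : ℂ[X]) ≠ 0 := fun h => hy <| by
      simpa [coeff_C] using congrArg (fun p => coeff p 1) h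
    filter_upwards [eventually_eval_ne_zero hp] with t ht
    simpa only [eval_add, eval_mul, eval_C, eval_X] using ht
  have hinj : ∀ (n : ℕ) (x : Fin n → ℂ), ∀ᶠ t in 𝓝[≠] (0 : ℂ),
      Function.Injective fun i => x i + t * ((i : ℂ) + 1) := by
    intro n x
    have : ∀ᶠ t in 𝓝[≠] (0 : ℂ), ∀ i j : Fin n, i ≠ j →
        x i - x j + t * ((i : ℂ) - j) ≠ 0 := by
      refine eventually_all.2 fun i => eventually_all.2 fun j => ?_
      by_cases hij : i = j
      · exact .of_forall fun t h => absurd hij h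
      · filter_upwards [hlin (x i - x j) ((i : ℂ) - j)
          (sub_ne_zero.2 fun h => hij (Fin.ext (by exact_mod_cast h)))] with t ht _ using ht
    filter_upwards [this] with t ht i j h
    by_contra hij
    exact ht i j hij (by linear_combination h)
  have hne : ∀ᶠ t in 𝓝[≠] (0 : ℂ), ∀ i : Fin k, a i + t * ((i : ℂ) + 1) ≠ 0 :=
    eventually_all.2 fun i => hlin _ _ (Nat.cast_add_one_ne_zero _)
  have hprod : ∀ᶠ t in 𝓝[≠] (0 : ℂ), ∀ (i : Fin k) (j : Fin k'),
      (a i + t * ((i : ℂ) + 1)) * (b j + t * ((j : ℂ) + 1)) ≠ 1 := by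
    refine eventually_all.2 fun i => eventually_all.2 fun j => ?_
    have hp : ((C (a i) + X * C ((i : ℂ) + 1)) * (C (b j) + X * C ((j : ℂ) + 1)) - 1 : ℂ[X]) ≠
        0 := by
      intro h
      have h2 : ((i : ℂ) + 1) * ((j : ℂ) + 1) = 0 := by
        have e1 := congrArg (eval (1 : ℂ)) h
        have e2 := congrArg (eval (-1 : ℂ)) h
        have e3 := congrArg (eval (0 : ℂ)) h
        simp only [eval_sub, eval_mul, eval_add, eval_C, eval_X, eval_one, eval_zero] at e1 e2 e3
        linear_combination (e1 + e2) / 2 - e3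
      exact mul_ne_zero (Nat.cast_add_one_ne_zero _) (Nat.cast_add_one_ne_zero _) h2
    filter_upwards [eventually_eval_ne_zero hp] with t ht h
    refine ht ?_
    simp only [eval_sub, eval_mul, eval_add, eval_C, eval_X, eval_one]
    rw [h, sub_self]
  have hev : ∀ᶠ t in 𝓝[≠] (0 : ℂ),
      detAvg μ (fun i => a i + t * ((i : ℂ) + 1)) (fun j => b j + t * ((j : ℂ) + 1)) =
        c * toep N k' (symbolPoly (fun i => a i + t * ((i : ℂ) + 1))
          (fun j => b j + t * ((j : ℂ) + 1))) := by
    filter_upwards [hinj k a, hinj k' b, hne, hprod] with t h1 h2 h3 h4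
    exact hc _ _ h3 h1 h2 h4
  have hac : Continuous fun (t : ℂ) (i : Fin k) => a i + t * ((i : ℂ) + 1) := by fun_prop
  have hbc : Continuous fun (t : ℂ) (i : Fin k') => b i + t * ((i : ℂ) + 1) := by fun_prop
  have hl := ((continuous_detAvg μ hac hbc).tendsto 0).mono_left (nhdsWithin_le_nhds (s := {0}ᶜ))
  have hr := ((continuous_const (y := c)).mul
    (continuous_toep_symbolPoly (N := N) hac hbc)).tendsto 0
    |>.mono_left (nhdsWithin_le_nhds (s := {0}ᶜ))
  have := tendsto_nhds_unique (hl.congr' hev) hr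
  simpa using this

lemma detAvg_zero (μ : Measure (unitaryGroup (Fin N) ℂ)) [IsProbabilityMeasure μ] :
    detAvg μ (0 : Fin k → ℂ) (0 : Fin k' → ℂ) = 1 := by
  simp [detAvg]

lemma toep_symbolPoly_zero : toep N k' (symbolPoly (0 : Fin k → ℂ) (0 : Fin k' → ℂ)) = 1 := by
  have h : (of fun j l : Fin N => (X ^ (l : ℕ) * symbolPoly (0 : Fin k → ℂ)
      (0 : Fin k' → ℂ)).coeff (k' + j)) = 1 := by
    ext j l
    simp [symbolPoly, ← pow_add, coeff_X_pow, one_apply, Fin.ext_iff, add_comm]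
  rw [toep, h, det_one]

end Assembly

end HeineSzego

/-- The Heine–Szegő identity: the average over `U(N)` of
`∏_i det(1 - a_i U) ∏_j det(1 - b_j U*)` equals the `N × N` Toeplitz determinant of the
Fourier coefficients of `φ(e^{iθ}) = ∏_i (1 - a_i e^{iθ}) ∏_j (1 - b_j e^{-iθ})`. -/
theorem unitary_average_eq_toeplitz_det (N : ℕ) (hN : 1 ≤ N) (k k' : ℕ)
    (a : Fin k → ℂ) (b : Fin k' → ℂ)
    (μ : Measure (Matrix.unitaryGroup (Fin N) ℂ))
    [IsProbabilityMeasure μ] [μ.IsHaarMeasure] :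
    (∫ U : Matrix.unitaryGroup (Fin N) ℂ,
        (∏ i : Fin k,
            ((1 : Matrix (Fin N) (Fin N) ℂ) - a i • (U : Matrix (Fin N) (Fin N) ℂ)).det) *
          (∏ j : Fin k',
            ((1 : Matrix (Fin N) (Fin N) ℂ) - b j • star (U : Matrix (Fin N) (Fin N) ℂ)).det) ∂μ)
      = (Matrix.of fun j k : Fin N =>
          fCoeff (phiSymbol a b) (((j : ℕ) : ℤ) - ((k : ℕ) : ℤ))).det := by
  obtain ⟨c, hc⟩ := HeineSzego.detAvg_eq_const_mul_toep hN k k' μ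
  have hc1 : c = 1 := by
    have := hc 0 0
    rw [HeineSzego.detAvg_zero, HeineSzego.toep_symbolPoly_zero, mul_one] at this
    exact this.symm
  rw [HeineSzego.det_fCoeff_eq_toep, ← one_mul (HeineSzego.toep _ _ _), ← hc1]
  exact hc a b
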